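/- arXiv:1407.5397 — 3 statements merged into one kernel-verified Lean document; each statement's English description precedes it below -/
import Mathlib

section
/- The classes of indexed families identifiable with arbitrary counterexamples and with history bounded counterexamples are incomparable: there exists an indexed family identified by some CEGIS engine but by no HCEGIS engine, and there exists an indexed family identified by some HCEGIS engine but by no CEGIS engine; in particular HCEGIS ≠ CEGIS and neither class contains the other. -/
/-- An indexed family of languages: a sequence of nonempty subsets of `ℕ` whose
two-argument membership predicate is decidable by a computable function. -/
def IsIndexedFamily (Lfam : ℕ → Set ℕ) : Prop :=
  (∀ i, (Lfam i).Nonempty) ∧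
  ∃ f : ℕ → ℕ → Bool, Computable₂ f ∧ ∀ i n, f i n = true ↔ n ∈ Lfam i

/-- A trace for a language `L` is a sequence of optional values whose set of
non-`none` values equals `L`. -/
def IsTrace (τ : ℕ → Option ℕ) (L : Set ℕ) : Prop :=
  {x : ℕ | ∃ n, τ n = some x} = L

/-- The candidate sequence of an engine with update function `F` and initial
index `p₀`, on trace `τ` and counterexample sequence `cex`. -/
def cand (F : ℕ → Option ℕ → Option ℕ → ℕ) (p₀ : ℕ) (τ cex : ℕ → Option ℕ) : ℕ → ℕ
  | 0 => p₀
  | n + 1 => F (cand F p₀ τ cex n) (τ n) (cex n)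

/-- The update function of an engine is computable. -/
def EngineComputable (F : ℕ → Option ℕ → Option ℕ → ℕ) : Prop :=
  Computable fun x : ℕ × Option ℕ × Option ℕ => F x.1 x.2.1 x.2.2

/-- Admissibility of a counterexample sequence for arbitrary counterexamples:
`cex n` is `none` when the `n`-th candidate language is a subset of the target
`L`, and otherwise is some element of the candidate language not in `L`. -/
def CexAdmissible (Lfam : ℕ → Set ℕ) (L : Set ℕ) (p : ℕ → ℕ) (cex : ℕ → Option ℕ) : Prop :=
  ∀ n, (Lfam (p n) ⊆ L → cex n = none) ∧
       (¬ Lfam (p n) ⊆ L → ∃ m, cex n = some m ∧ m ∈ Lfam (p n) \ L)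

/-- Admissibility for minimal counterexamples: `cex n` is `none` when the `n`-th
candidate language is a subset of `L`, and otherwise is the least element of the
candidate language minus `L`. -/
def MinCexAdmissible (Lfam : ℕ → Set ℕ) (L : Set ℕ) (p : ℕ → ℕ) (cex : ℕ → Option ℕ) : Prop :=
  ∀ n, (Lfam (p n) ⊆ L → cex n = none) ∧
       (¬ Lfam (p n) ⊆ L → cex n = some (sInf (Lfam (p n) \ L)))

/-- Admissibility for history bounded counterexamples: `cex n` is some element
`m` of the candidate language minus `L` with `m` strictly below some earlier
trace value, and `none` if no such element exists. -/
def HCexAdmissible (Lfam : ℕ → Set ℕ) (L : Set ℕ) (τ : ℕ → Option ℕ)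
    (p : ℕ → ℕ) (cex : ℕ → Option ℕ) : Prop :=
  ∀ n,
    ((∃ m, m ∈ Lfam (p n) \ L ∧ ∃ j ≤ n, ∃ v, τ j = some v ∧ m < v) →
      ∃ m, cex n = some m ∧ m ∈ Lfam (p n) \ L ∧ ∃ j ≤ n, ∃ v, τ j = some v ∧ m < v) ∧
    ((¬ ∃ m, m ∈ Lfam (p n) \ L ∧ ∃ j ≤ n, ∃ v, τ j = some v ∧ m < v) → cex n = none)

/-- The candidate sequence is eventually constant with a value indexing the
target language. -/
def ConvergesTo (Lfam : ℕ → Set ℕ) (L : Set ℕ) (p : ℕ → ℕ) : Prop :=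
  ∃ N j, Lfam j = L ∧ ∀ n ≥ N, p n = j

/-- A CEGIS engine identifies the language `L` of the family `Lfam`. -/
def CEGISIdentifies (F : ℕ → Option ℕ → Option ℕ → ℕ) (p₀ : ℕ)
    (Lfam : ℕ → Set ℕ) (L : Set ℕ) : Prop :=
  ∀ τ, IsTrace τ L → ∀ cex, CexAdmissible Lfam L (cand F p₀ τ cex) cex →
    ConvergesTo Lfam L (cand F p₀ τ cex)

/-- A MinCEGIS engine identifies the language `L` of the family `Lfam`. -/
def MinCEGISIdentifies (F : ℕ → Option ℕ → Option ℕ → ℕ) (p₀ : ℕ)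
    (Lfam : ℕ → Set ℕ) (L : Set ℕ) : Prop :=
  ∀ τ, IsTrace τ L → ∀ cex, MinCexAdmissible Lfam L (cand F p₀ τ cex) cex →
    ConvergesTo Lfam L (cand F p₀ τ cex)

/-- An HCEGIS engine identifies the language `L` of the family `Lfam`. -/
def HCEGISIdentifies (F : ℕ → Option ℕ → Option ℕ → ℕ) (p₀ : ℕ)
    (Lfam : ℕ → Set ℕ) (L : Set ℕ) : Prop :=
  ∀ τ, IsTrace τ L → ∀ cex, HCexAdmissible Lfam L τ (cand F p₀ τ cex) cex →
    ConvergesTo Lfam L (cand F p₀ τ cex)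

/-- The family `Lfam` is in the class CEGIS. -/
def InCEGIS (Lfam : ℕ → Set ℕ) : Prop :=
  ∃ F p₀, EngineComputable F ∧ ∀ i, CEGISIdentifies F p₀ Lfam (Lfam i)

/-- The family `Lfam` is in the class MinCEGIS. -/
def InMinCEGIS (Lfam : ℕ → Set ℕ) : Prop :=
  ∃ F p₀, EngineComputable F ∧ ∀ i, MinCEGISIdentifies F p₀ Lfam (Lfam i)

/-- The family `Lfam` is in the class HCEGIS. -/
def InHCEGIS (Lfam : ℕ → Set ℕ) : Prop :=
  ∃ F p₀, EngineComputable F ∧ ∀ i, HCEGISIdentifies F p₀ Lfam (Lfam i)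

/-- The family consisting of `ℕ` (index `0`) and its nonempty initial segments. -/
def segmentFamily (i : ℕ) : Set ℕ := {x | i = 0 ∨ x < i}

theorem segmentFamily_zero : segmentFamily 0 = Set.univ := by
  ext x; simp [segmentFamily]

theorem mem_segmentFamily {i x : ℕ} : x ∈ segmentFamily i ↔ i = 0 ∨ x < i := Iff.rfl

theorem segmentFamily_injective : Function.Injective segmentFamily := by
  intro i j h
  have h1 := Set.ext_iff.1 h i
  have h2 := Set.ext_iff.1 h j
  have h3 := Set.ext_iff.1 h (i + j)
  simp only [mem_segmentFamily] at h1 h2 h3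
  omega

theorem segmentFamily_isIndexedFamily : IsIndexedFamily segmentFamily := by
  refine ⟨fun i => ⟨0, ?_⟩, fun i x => decide (i = 0 ∨ x < i), ?_, ?_⟩
  · rw [mem_segmentFamily]; omega
  · refine Primrec.to_comp ?_
    refine PrimrecPred.decide ?_
    exact (Primrec.eq.comp Primrec.fst (Primrec.const 0)).or
      (Primrec.nat_lt.comp Primrec.snd Primrec.fst)
  · intro i x; simp [mem_segmentFamily]

/-- The engine conjecturing `ℕ` until it sees a counterexample, and then the least
initial segment containing the data. -/
def segmentEngine (p : ℕ) (t c : Option ℕ) : ℕ :=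
  if p = 0 then (if c = none then 0 else t.elim 1 (· + 1)) else max p (t.elim 0 (· + 1))

theorem primrec_option_elim_succ (k : ℕ) :
    Primrec fun x : ℕ × Option ℕ × Option ℕ => x.2.1.elim k (· + 1) := by
  have h : Primrec₂ fun (_ : ℕ × Option ℕ × Option ℕ) (b : ℕ) => b + 1 :=
    Primrec.succ.comp₂ Primrec₂.right
  refine (Primrec.option_casesOn (Primrec.fst.comp Primrec.snd) (Primrec.const k) h).of_eq ?_
  rintro ⟨p, _ | t, c⟩ <;> rfl

theorem segmentEngine_computable : EngineComputable segmentEngine := by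
  refine Primrec.to_comp ?_
  unfold segmentEngine
  refine Primrec.ite (Primrec.eq.comp Primrec.fst (Primrec.const 0)) (Primrec.ite
    (Primrec.eq.comp (Primrec.snd.comp Primrec.snd) (Primrec.const none)) (Primrec.const 0)
      (primrec_option_elim_succ 1))
    (Primrec.nat_max.comp Primrec.fst (primrec_option_elim_succ 0))

/-- A monotone bounded sequence of naturals is eventually constant. -/
theorem eventually_const_of_monotone_bounded (f : ℕ → ℕ) (N b : ℕ)
    (hm : ∀ n ≥ N, f n ≤ f (n + 1)) (hb : ∀ n ≥ N, f n ≤ b) :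
    ∃ K ≥ N, ∀ n ≥ K, f n = f K := by
  have hmono : ∀ k, ∀ n ≥ N, f n ≤ f (n + k) := by
    intro k
    induction k with
    | zero => intro n _; exact le_rfl
    | succ k ih => intro n hn; exact (ih n hn).trans (hm (n + k) (by omega))
  by_contra! h
  have : ∀ k, ∃ n ≥ N, k ≤ f n := by
    intro k
    induction k with
    | zero => exact ⟨N, le_rfl, Nat.zero_le _⟩
    | succ k ih =>
      obtain ⟨n, hn, hk⟩ := ih
      obtain ⟨m, hm1, hm2⟩ := h n hn
      have := hmono (m - n) n hn
      rw [Nat.add_sub_cancel' hm1] at this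
      exact ⟨m, by omega, by omega⟩
  obtain ⟨n, hn, h1⟩ := this (b + 1)
  have := hb n hn
  omega

theorem segmentFamily_inCEGIS : InCEGIS segmentFamily := by
  refine ⟨segmentEngine, 0, segmentEngine_computable, fun i τ hτ cex hcex => ?_⟩
  set p := cand segmentEngine 0 τ cex with hp
  have hstep : ∀ n, p (n + 1) = segmentEngine (p n) (τ n) (cex n) := fun n => rfl
  have hmem : ∀ n v, τ n = some v → v ∈ segmentFamily i := by
    intro n v h; rw [← hτ]; exact ⟨n, h⟩
  rcases Nat.eq_zero_or_pos i with rfl | hi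
  · refine ⟨0, 0, rfl, fun n _ => ?_⟩
    induction n with
    | zero => rfl
    | succ n ih =>
      have := (hcex n).1 (by rw [segmentFamily_zero]; exact Set.subset_univ _)
      rw [hstep, ih (Nat.zero_le _), this]; simp [segmentEngine]
  have hmem' : ∀ n, (τ n).elim 1 (· + 1) ≤ i ∧ 1 ≤ (τ n).elim 1 (· + 1) ∧
      (τ n).elim 0 (· + 1) ≤ i := by
    intro n
    cases h : τ n with
    | none => simp; omega
    | some v => have := hmem n v h; rw [mem_segmentFamily] at this; simp; omega
  have hinv : ∀ n ≥ 1, 1 ≤ p n ∧ p n ≤ i := by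
    intro n hn
    induction n, hn using Nat.le_induction with
    | base =>
      have h0 : p 0 = 0 := rfl
      have hc : cex 0 ≠ none := by
        obtain ⟨m, hm, -⟩ := (hcex 0).2 (by
          show ¬ segmentFamily (p 0) ⊆ _
          rw [h0, segmentFamily_zero]
          intro h
          have := h (Set.mem_univ i)
          rw [mem_segmentFamily] at this; omega)
        simp [hm]
      have := hmem' 0
      rw [hstep, h0]; simp only [segmentEngine, hc, if_true, if_false]; omega
    | succ n hn ih =>
      have := hmem' n
      have h0 : p n ≠ 0 := by omega
      rw [hstep]; simp only [segmentEngine, h0, if_false]; omega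
  have hmono : ∀ n ≥ 1, p n ≤ p (n + 1) ∧ (τ n).elim 0 (· + 1) ≤ p (n + 1) := by
    intro n hn
    have h0 : p n ≠ 0 := by have := hinv n hn; omega
    rw [hstep]; simp only [segmentEngine, h0, if_false]; omega
  obtain ⟨K, hK, hc⟩ := eventually_const_of_monotone_bounded p 1 i (fun n hn => (hmono n hn).1)
    (fun n hn => (hinv n hn).2)
  refine ⟨K, p K, ?_, hc⟩
  have hle : i ≤ p K := by
    have : i - 1 ∈ segmentFamily i := by rw [mem_segmentFamily]; omega
    rw [← hτ] at this
    obtain ⟨n, hn⟩ := this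
    have h1 : i ≤ p (n + 1) := by
      rcases Nat.eq_zero_or_pos n with rfl | hn0
      · have h0 : p 0 = 0 := rfl
        have h2 := (hinv 1 le_rfl).1
        rw [hstep, h0, hn] at h2 ⊢
        by_cases hc0 : cex 0 = none
        · simp [segmentEngine, hc0] at h2
        · simp only [segmentEngine, hc0, if_true, if_false, Option.elim]; omega
      · have := (hmono n hn0).2; rw [hn] at this; simp at this; omega
    have h3 : ∀ m, p (n + 1) ≤ p (n + 1 + m) := by
      intro m
      induction m with
      | zero => exact le_rfl
      | succ m ih => exact ih.trans (hmono (n + 1 + m) (by omega)).1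
    have h4 := h3 K
    rw [hc (n + 1 + K) (by omega)] at h4
    omega
  have := (hinv K hK).2
  rw [le_antisymm this hle]

theorem hcexAdmissible_segmentFamily {L : ℕ} {τ : ℕ → Option ℕ} (p : ℕ → ℕ)
    (hτ : IsTrace τ (segmentFamily L)) :
    HCexAdmissible segmentFamily (segmentFamily L) τ p fun _ => none := by
  refine fun n => ⟨?_, fun _ => rfl⟩
  rintro ⟨m, ⟨-, hm⟩, j, -, v, hv, hmv⟩
  have : v ∈ segmentFamily L := by rw [← hτ]; exact ⟨j, hv⟩
  rw [mem_segmentFamily] at this hm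
  omega

theorem segmentFamily_not_inHCEGIS : ¬ InHCEGIS segmentFamily := by
  rintro ⟨F, p₀, -, hF⟩
  set τ : ℕ → Option ℕ := fun n => some (Nat.unpair n).1 with hτdef
  have hτ : IsTrace τ (segmentFamily 0) := by
    rw [segmentFamily_zero]
    refine Set.eq_univ_of_forall fun x => ⟨Nat.pair x 0, by simp [hτdef]⟩
  obtain ⟨N, j, hj, hN⟩ := hF 0 τ hτ _ (hcexAdmissible_segmentFamily _ hτ)
  obtain rfl : j = 0 := segmentFamily_injective hj
  have hstay : ∀ x, F 0 (some x) none = 0 := by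
    intro x
    have h1 := hN (Nat.pair x N) (Nat.right_le_pair x N)
    have h2 := hN (Nat.pair x N + 1) ((Nat.right_le_pair x N).trans (Nat.le_succ _))
    rw [cand, h1] at h2
    simpa [hτdef] using h2
  set τ' : ℕ → Option ℕ := fun n => if n < N then τ n else some (n % (N + 1)) with hτ'def
  have hτ' : IsTrace τ' (segmentFamily (N + 1)) := by
    ext x
    rw [mem_segmentFamily]
    constructor
    · rintro ⟨n, hn⟩
      right
      simp only [hτ'def, hτdef] at hn
      split_ifs at hn with h
      · have := Nat.unpair_left_le n
        simp at hn; omega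
      · have := Nat.mod_lt n (show N + 1 > 0 by omega)
        simp at hn; omega
    · intro h
      refine ⟨x + (N + 1) * N, ?_⟩
      have h1 : ¬ x + (N + 1) * N < N := by nlinarith
      simp only [hτ'def, h1, if_false, Nat.add_mul_mod_self_left]
      rw [Nat.mod_eq_of_lt (by omega)]
  obtain ⟨K, j, hj, hK⟩ := hF (N + 1) τ' hτ' _ (hcexAdmissible_segmentFamily _ hτ')
  obtain rfl : j = N + 1 := segmentFamily_injective hj
  have hagree : ∀ n ≤ N, cand F p₀ τ' (fun _ => none) n = cand F p₀ τ (fun _ => none) n := by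
    intro n hn
    induction n with
    | zero => rfl
    | succ n ih =>
      have : n < N := hn
      rw [cand, cand, ih (by omega)]
      simp [hτ'def, this]
  have hzero : ∀ n ≥ N, cand F p₀ τ' (fun _ => none) n = 0 := by
    intro n hn
    induction n, hn using Nat.le_induction with
    | base => rw [hagree N le_rfl, hN N le_rfl]
    | succ n hn ih =>
      rw [cand, ih]
      have : ¬ n < N := by omega
      simp only [hτ'def, this, if_false]
      exact hstay _
  have h1 := hK (max K N) (le_max_left _ _)
  rw [hzero _ (le_max_right _ _)] at h1
  omega

/-- A partial recursive function is the limit of computable approximations which converge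
at exactly one stage. -/
theorem exists_stage_function {g : ℕ →. ℕ} (hg : Partrec g) :
    ∃ s : ℕ → ℕ → Option ℕ, Computable₂ s ∧ (∀ e k v, s e k = some v → v ∈ g e) ∧
      (∀ e, (g e).Dom → ∃ k, (s e k).isSome) ∧
      (∀ e k k', (s e k).isSome → (s e k').isSome → k = k') := by
  obtain ⟨c, rfl⟩ := Nat.Partrec.Code.exists_code.1 (Partrec.nat_iff.1 hg)
  set t : ℕ → ℕ → Option ℕ := fun e k => Nat.Partrec.Code.evaln k c e with ht
  have htp : Primrec₂ t := Nat.Partrec.Code.primrec_evaln.comp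
    (Primrec.pair (Primrec.pair Primrec.snd (Primrec.const c)) Primrec.fst)
  have ht0 : ∀ e, t e 0 = none := fun e => by simp [ht, Nat.Partrec.Code.evaln]
  have htmono : ∀ e k k' v, k ≤ k' → t e k = some v → t e k' = some v :=
    fun e k k' v hk h => Nat.Partrec.Code.evaln_mono hk h
  set s : ℕ → ℕ → Option ℕ := fun e k => if k = 0 ∨ (t e (k - 1)).isSome then none else t e k
    with hs
  have hsmem : ∀ e k, (s e k).isSome ↔ k ≠ 0 ∧ (t e (k - 1)).isSome = false ∧ (t e k).isSome := by
    intro e k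
    simp only [hs]
    split_ifs with h
    · rcases h with h | h
      · simp [h]
      · simp only [h]; simp
    · simp only [not_or] at h; simp [h]
  refine ⟨s, Primrec₂.to_comp ?_, ?_, ?_, ?_⟩
  · refine Primrec.ite (PrimrecPred.or ?_ ?_) (Primrec.const none) htp
    · exact Primrec.eq.comp Primrec.snd (Primrec.const 0)
    · exact Primrec.primrecPred (p := fun z : ℕ × ℕ => (t z.1 (z.2 - 1)).isSome = true)
        ((Primrec.option_isSome.comp (htp.comp Primrec.fst
          (Primrec.nat_sub.comp Primrec.snd (Primrec.const 1)))).of_eq (fun _ => by simp))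
  · intro e k v h
    simp only [hs] at h
    split_ifs at h
    exact Nat.Partrec.Code.evaln_sound h
  · intro e he
    obtain ⟨k, hk⟩ := Nat.Partrec.Code.evaln_complete.1 (Part.get_mem he)
    have hex : ∃ k, (t e k).isSome := ⟨k, Option.isSome_iff_exists.2 ⟨_, hk⟩⟩
    classical
    have h0 : Nat.find hex ≠ 0 := by
      intro h0
      have h1 := Nat.find_spec hex
      rw [h0, ht0] at h1
      simp at h1
    refine ⟨Nat.find hex, (hsmem _ _).2 ⟨h0, ?_, Nat.find_spec hex⟩⟩
    by_contra h
    rw [Bool.not_eq_false] at h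
    have := Nat.find_min' hex h
    omega
  · have key : ∀ e k k', (s e k).isSome → (s e k').isSome → ¬ k < k' := by
      intro e k k' h h' hlt
      rw [hsmem] at h h'
      obtain ⟨v, hv⟩ := Option.isSome_iff_exists.1 h.2.2
      have := htmono e k (k' - 1) v (by omega) hv
      rw [this] at h'
      simp at h'
    intro e k k' h h'
    have h1 := key e k k' h h'
    have h2 := key e k' k h' h
    omega

/-- Iterate a partial step function. -/
def runPart (f : ℕ → ℕ → Part ℕ) (q₀ n : ℕ) : Part ℕ :=
  n.rec (Part.some q₀) fun m ih => ih.bind (f m)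

/-- Iterate a partial step function until a stopping state is met; return that state and the
number of steps made. -/
def haltPart (f : ℕ → ℕ → Part ℕ) (q₀ : ℕ) (halted : ℕ → Bool) : Part (ℕ × ℕ) :=
  (Nat.rfind fun n => (runPart f q₀ n).map halted).bind fun n =>
    (runPart f q₀ n).map fun q => (q, n)

theorem partrec_haltPart {α : Type} [Primcodable α] {f : α → ℕ → ℕ → Part ℕ} {q₀ : α → ℕ}
    {halted : α → ℕ → Bool} (hf : Partrec fun z : α × ℕ × ℕ => f z.1 z.2.1 z.2.2)
    (hq : Computable q₀) (hs : Computable₂ halted) :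
    Partrec fun z => haltPart (f z) (q₀ z) (halted z) := by
  have hrun : Partrec₂ fun (z : α) n => runPart (f z) (q₀ z) n :=
    Partrec.nat_rec (f := fun z : α × ℕ => z.2) (g := fun z : α × ℕ => Part.some (q₀ z.1))
      (h := fun z (y : ℕ × ℕ) => f z.1 y.1 y.2) Computable.snd
      (hq.comp Computable.fst).partrec
      (hf.comp ((Computable.fst.comp Computable.fst).pair Computable.snd))
  refine Partrec.bind (Partrec.rfind ?_) ?_
  · exact Partrec.map hrun (hs.comp (Computable.fst.comp Computable.fst) Computable.snd)
  · exact Partrec.map hrun (Computable.snd.pair (Computable.snd.comp Computable.fst))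

theorem haltPart_pos {f : ℕ → ℕ → Part ℕ} {q₀ : ℕ} {halted : ℕ → Bool} {r : ℕ × ℕ}
    (hr : r ∈ haltPart f q₀ halted) (h0 : halted q₀ = false) : 1 ≤ r.2 := by
  simp only [haltPart, Part.mem_bind_iff, Part.mem_map_iff] at hr
  obtain ⟨n, hn, s, hs, rfl⟩ := hr
  have h1 := Nat.rfind_spec hn
  rcases Nat.eq_zero_or_pos n with rfl | h
  · simp [runPart, h0] at h1
  · exact h

theorem runPart_succ (f : ℕ → ℕ → Part ℕ) (q₀ n : ℕ) :
    runPart f q₀ (n + 1) = (runPart f q₀ n).bind (f n) :=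
  rfl

theorem runPart_total {f : ℕ → ℕ → Part ℕ} {Q : ℕ → ℕ}
    (hQ : ∀ n, f n (Q n) = Part.some (Q (n + 1))) (n : ℕ) :
    runPart f (Q 0) n = Part.some (Q n) := by
  induction n with
  | zero => rfl
  | succ n ih => rw [runPart_succ, ih, Part.bind_some, hQ]

theorem mem_haltPart_total {f : ℕ → ℕ → Part ℕ} {Q : ℕ → ℕ} {halted : ℕ → Bool} {r : ℕ × ℕ}
    (hQ : ∀ n, f n (Q n) = Part.some (Q (n + 1))) (hr : r ∈ haltPart f (Q 0) halted) :
    r.1 = Q r.2 ∧ halted (Q r.2) = true ∧ ∀ m < r.2, halted (Q m) = false := by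
  simp only [haltPart, Part.mem_bind_iff, Part.mem_map_iff] at hr
  obtain ⟨n, hn, s, hs, rfl⟩ := hr
  rw [runPart_total hQ] at hs
  obtain rfl := Part.mem_some_iff.1 hs
  refine ⟨rfl, ?_, fun m hmn => ?_⟩
  · have h : true ∈ (runPart f (Q 0) n).map halted := Nat.rfind_spec hn
    rw [runPart_total hQ, Part.map_some, Part.mem_some_iff] at h
    exact h.symm
  · have h : false ∈ (runPart f (Q 0) m).map halted := Nat.rfind_min hn hmn
    rw [runPart_total hQ, Part.map_some, Part.mem_some_iff] at h
    exact h.symm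

theorem haltPart_dom {f : ℕ → ℕ → Part ℕ} {Q : ℕ → ℕ} {halted : ℕ → Bool}
    (hQ : ∀ n, f n (Q n) = Part.some (Q (n + 1))) (h : ∃ n, halted (Q n) = true) :
    (haltPart f (Q 0) halted).Dom := by
  obtain ⟨k, hk⟩ := h
  have hdom : (Nat.rfind fun n => (runPart f (Q 0) n).map halted).Dom := by
    refine Nat.rfind_dom.2 ⟨k, ?_, fun {m} _ => ?_⟩
    · rw [runPart_total hQ, Part.map_some, Part.mem_some_iff, hk]
    · rw [runPart_total hQ]; trivial
  obtain ⟨n, hn⟩ := Part.dom_iff_mem.1 hdom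
  rw [Part.dom_iff_mem]
  refine ⟨(Q n, n), ?_⟩
  simp only [haltPart, Part.mem_bind_iff]
  exact ⟨n, hn, by rw [runPart_total hQ]; simp⟩

/-- Two computable stage functions. For each `e`, at most one `k` has `fst e k = some a`, and
then it announces a bound `a`; at most one `k` has `snd e k = some (Nat.pair a n)`, and then
`a` has been announced by `fst` and `n` is positive. -/
structure StagePair where
  fst : ℕ → ℕ → Option ℕ
  snd : ℕ → ℕ → Option ℕ
  computable_fst : Computable₂ fst
  computable_snd : Computable₂ snd
  fst_unique : ∀ e k k', (fst e k).isSome → (fst e k').isSome → k = k'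
  snd_unique : ∀ e k k', (snd e k).isSome → (snd e k').isSome → k = k'
  fst_pos : ∀ e k a, fst e k = some a → 1 ≤ a
  snd_spec : ∀ e k v, snd e k = some v → 1 ≤ v.unpair.2 ∧ ∃ t, fst e t = some v.unpair.1

/-- The initial segment up to `a`, together with the first `n` terms of the data sequence
interleaving `1, 2, 3, …` and `a + 5, a + 9, a + 13, …`. -/
def gapSet (a n : ℕ) : Set ℕ :=
  {x | x ≤ a ∨ (1 ≤ x ∧ 2 * x < n + 1) ∨
    (a + 5 ≤ x ∧ (x - (a + 5)) % 4 = 0 ∧ 2 * ((x - (a + 5)) / 4) < n)}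

theorem mem_gapSet {a n x : ℕ} : x ∈ gapSet a n ↔ x ≤ a ∨ (1 ≤ x ∧ 2 * x < n + 1) ∨
    (a + 5 ≤ x ∧ (x - (a + 5)) % 4 = 0 ∧ 2 * ((x - (a + 5)) / 4) < n) := Iff.rfl

namespace StagePair

variable (S : StagePair)

/-- The slices out of which the family is built: all positive numbers, a bounded initial
segment, an initial segment with a finite set having gaps, or just `{1}`. -/
def slice (e j : ℕ) : Set ℕ :=
  {x | x = 1 ∨ (j = Nat.pair 1 0 ∧ 1 ≤ x) ∨
    (j.unpair.1 = 2 ∧ ∃ a ∈ S.fst e j.unpair.2, x ≤ a) ∨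
    (j.unpair.1 = 3 ∧ ∃ v ∈ S.snd e j.unpair.2, x ∈ gapSet v.unpair.1 v.unpair.2)}

/-- The language with index `Nat.pair e j` is the copy of `S.slice e j` in column `e`. -/
def family (i : ℕ) : Set ℕ :=
  {v | v.unpair.1 = i.unpair.1 ∧ v.unpair.2 ∈ S.slice i.unpair.1 i.unpair.2}

theorem mem_slice {e j x : ℕ} : x ∈ S.slice e j ↔ x = 1 ∨ (j = Nat.pair 1 0 ∧ 1 ≤ x) ∨
    (j.unpair.1 = 2 ∧ ∃ a ∈ S.fst e j.unpair.2, x ≤ a) ∨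
    (j.unpair.1 = 3 ∧ ∃ v ∈ S.snd e j.unpair.2, x ∈ gapSet v.unpair.1 v.unpair.2) := Iff.rfl

theorem mem_family {i v : ℕ} :
    v ∈ S.family i ↔ v.unpair.1 = i.unpair.1 ∧ v.unpair.2 ∈ S.slice i.unpair.1 i.unpair.2 :=
  Iff.rfl

theorem one_mem_slice (e j : ℕ) : 1 ∈ S.slice e j := Or.inl rfl

theorem pair_mem_family {e x i : ℕ} :
    Nat.pair e x ∈ S.family i ↔ e = i.unpair.1 ∧ x ∈ S.slice i.unpair.1 i.unpair.2 := by
  simp [mem_family]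

theorem mem_slice_pos {e x : ℕ} : x ∈ S.slice e (Nat.pair 1 0) ↔ 1 ≤ x := by
  rw [mem_slice]; simp; omega

theorem mem_slice_fst {e k a x : ℕ} (h : S.fst e k = some a) :
    x ∈ S.slice e (Nat.pair 2 k) ↔ x ≤ a := by
  have := S.fst_pos e k a h
  rw [mem_slice]; simp [h]; omega

theorem mem_slice_snd {e k v x : ℕ} (h : S.snd e k = some v) :
    x ∈ S.slice e (Nat.pair 3 k) ↔ x ∈ gapSet v.unpair.1 v.unpair.2 := by
  obtain ⟨-, t, ht⟩ := S.snd_spec e k v h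
  have := S.fst_pos e t _ ht
  rw [mem_slice]; simp [h, mem_gapSet]; omega

theorem slice_cases (e j : ℕ) :
    j = Nat.pair 1 0 ∨ (∃ k a, j = Nat.pair 2 k ∧ S.fst e k = some a) ∨
      (∃ k v, j = Nat.pair 3 k ∧ S.snd e k = some v) ∨ ∀ x, x ∈ S.slice e j ↔ x = 1 := by
  by_cases h1 : j = Nat.pair 1 0
  · exact Or.inl h1
  by_cases h2 : j.unpair.1 = 2 ∧ ∃ a, S.fst e j.unpair.2 = some a
  · obtain ⟨h, a, ha⟩ := h2
    exact Or.inr (Or.inl ⟨j.unpair.2, a, by rw [← h, Nat.pair_unpair], ha⟩)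
  by_cases h3 : j.unpair.1 = 3 ∧ ∃ v, S.snd e j.unpair.2 = some v
  · obtain ⟨h, a, ha⟩ := h3
    exact Or.inr (Or.inr (Or.inl ⟨j.unpair.2, a, by rw [← h, Nat.pair_unpair], ha⟩))
  refine Or.inr (Or.inr (Or.inr fun x => ?_))
  rw [mem_slice]
  refine ⟨?_, Or.inl⟩
  rintro (h | h | ⟨h, a, ha, -⟩ | ⟨h, a, ha, -⟩)
  · exact h
  · exact absurd h.1 h1
  · exact absurd ⟨h, a, ha⟩ h2
  · exact absurd ⟨h, a, ha⟩ h3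

end StagePair

theorem primrec_unpair_fst : Primrec fun n : ℕ => n.unpair.1 := Primrec.fst.comp Primrec.unpair

theorem primrec_unpair_snd : Primrec fun n : ℕ => n.unpair.2 := Primrec.snd.comp Primrec.unpair

theorem primrecPred_gapSet :
    PrimrecPred fun z : (ℕ × ℕ) × ℕ => z.2 ∈ gapSet z.1.1 z.1.2 := by
  have ha : Primrec fun z : (ℕ × ℕ) × ℕ => z.1.1 := Primrec.fst.comp Primrec.fst
  have hn : Primrec fun z : (ℕ × ℕ) × ℕ => z.1.2 := Primrec.snd.comp Primrec.fst
  have hx : Primrec fun z : (ℕ × ℕ) × ℕ => z.2 := Primrec.snd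
  have ha5 : Primrec fun z : (ℕ × ℕ) × ℕ => z.1.1 + 5 := Primrec.nat_add.comp ha (Primrec.const 5)
  have hd : Primrec fun z : (ℕ × ℕ) × ℕ => z.2 - (z.1.1 + 5) := Primrec.nat_sub.comp hx ha5
  have h2 : ∀ {f : (ℕ × ℕ) × ℕ → ℕ}, Primrec f → Primrec fun z => 2 * f z :=
    fun hf => Primrec.nat_mul.comp (Primrec.const 2) hf
  refine ((Primrec.nat_le.comp hx ha).or (((Primrec.nat_le.comp (Primrec.const 1) hx).and
    (Primrec.nat_lt.comp (h2 hx) (Primrec.nat_add.comp hn (Primrec.const 1)))).or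
    ((Primrec.nat_le.comp ha5 hx).and ((Primrec.eq.comp (Primrec.nat_mod.comp hd (Primrec.const 4))
    (Primrec.const 0)).and (Primrec.nat_lt.comp
      (h2 (Primrec.nat_div.comp hd (Primrec.const 4))) hn))))).of_eq ?_
  intro z; rfl

theorem primrecPred_ne_none : PrimrecPred fun o : Option ℕ => o ≠ none :=
  (Primrec.eq.comp Primrec.id (Primrec.const none)).not

theorem primrec_getD_zero : Primrec fun o : Option ℕ => o.getD 0 :=
  (Primrec.option_getD.comp Primrec.id (Primrec.const 0))

/-- Membership in a slice as a function of the relevant stage values. -/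
def slicePred (o p : Option ℕ) (j x : ℕ) : Prop :=
  x = 1 ∨ (j = Nat.pair 1 0 ∧ 1 ≤ x) ∨ (j.unpair.1 = 2 ∧ o ≠ none ∧ x ≤ o.getD 0) ∨
    (j.unpair.1 = 3 ∧ p ≠ none ∧ x ∈ gapSet (p.getD 0).unpair.1 (p.getD 0).unpair.2)

theorem primrecPred_slicePred : PrimrecPred fun z : (Option ℕ × Option ℕ) × ℕ × ℕ =>
    slicePred z.1.1 z.1.2 z.2.1 z.2.2 := by
  have ho : Primrec fun z : (Option ℕ × Option ℕ) × ℕ × ℕ => z.1.1 := Primrec.fst.comp Primrec.fst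
  have hp : Primrec fun z : (Option ℕ × Option ℕ) × ℕ × ℕ => z.1.2 := Primrec.snd.comp Primrec.fst
  have hj : Primrec fun z : (Option ℕ × Option ℕ) × ℕ × ℕ => z.2.1 := Primrec.fst.comp Primrec.snd
  have hx : Primrec fun z : (Option ℕ × Option ℕ) × ℕ × ℕ => z.2.2 := Primrec.snd.comp Primrec.snd
  have hj1 := primrec_unpair_fst.comp hj
  have hv := primrec_getD_zero.comp hp
  refine (Primrec.eq.comp hx (Primrec.const 1)).or
    (((Primrec.eq.comp hj (Primrec.const _)).and (Primrec.nat_le.comp (Primrec.const 1) hx)).or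
    (((Primrec.eq.comp hj1 (Primrec.const 2)).and ((primrecPred_ne_none.comp ho).and
      (Primrec.nat_le.comp hx (primrec_getD_zero.comp ho)))).or
    ((Primrec.eq.comp hj1 (Primrec.const 3)).and ((primrecPred_ne_none.comp hp).and
      (primrecPred_gapSet.comp (Primrec.pair (Primrec.pair (primrec_unpair_fst.comp hv)
        (primrec_unpair_snd.comp hv)) hx))))))

namespace StagePair

variable (S : StagePair)

theorem slicePred_iff {e j x : ℕ} :
    slicePred (S.fst e j.unpair.2) (S.snd e j.unpair.2) j x ↔ x ∈ S.slice e j := by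
  rw [mem_slice, slicePred]
  cases S.fst e j.unpair.2 <;> cases S.snd e j.unpair.2 <;> simp

theorem family_isIndexedFamily : IsIndexedFamily S.family := by
  classical
  refine ⟨fun i => ⟨Nat.pair i.unpair.1 1, S.pair_mem_family.2 ⟨rfl, S.one_mem_slice _ _⟩⟩,
    fun i v => decide (v ∈ S.family i), ?_, fun i v => by simp⟩
  have hi : Computable fun z : ℕ × ℕ => z.1 := Computable.fst
  have he : Computable fun z : ℕ × ℕ => z.1.unpair.1 := primrec_unpair_fst.to_comp.comp hi
  have hj : Computable fun z : ℕ × ℕ => z.1.unpair.2 := primrec_unpair_snd.to_comp.comp hi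
  have hk : Computable fun z : ℕ × ℕ => z.1.unpair.2.unpair.2 := primrec_unpair_snd.to_comp.comp hj
  have hx : Computable fun z : ℕ × ℕ => z.2.unpair.2 :=
    primrec_unpair_snd.to_comp.comp Computable.snd
  have h1 := primrecPred_slicePred.decide.to_comp.comp
    (((S.computable_fst.comp he hk).pair (S.computable_snd.comp he hk)).pair (hj.pair hx))
  have h2 := (Primrec.eq.comp (primrec_unpair_fst.comp Primrec.snd)
    (primrec_unpair_fst.comp Primrec.fst) : PrimrecPred fun z : ℕ × ℕ =>
      z.2.unpair.1 = z.1.unpair.1).decide.to_comp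
  refine (Primrec.and.to_comp.comp h2 h1).of_eq fun z => ?_
  simp [slicePred_iff, mem_family]

end StagePair

/-- One step of the history bounded engine inside a column. The arguments `o`, `p` are the stage
values at the current parameter, `q` is the one at the first component of that parameter, `j` is
the current conjecture, `x` the current datum and `c` tells whether a counterexample was given. -/
def sliceStep (o p q : Option ℕ) (j x : ℕ) (c : Bool) : ℕ :=
  if j.unpair.1 = 0 then
    if x = 0 then Nat.pair 4 (Nat.pair 0 0) else if x = 1 then j else Nat.pair 1 0
  else if j.unpair.1 = 1 then
    if c = true then Nat.pair 3 0 else if x = 0 then Nat.pair 4 (Nat.pair 0 0) else j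
  else if j.unpair.1 = 2 then
    if o ≠ none ∧ o.getD 0 < x then Nat.pair 3 0 else j
  else if j.unpair.1 = 3 then
    if p ≠ none then j else Nat.pair 3 (j.unpair.2 + 1)
  else
    if q = none then
      Nat.pair 4 (Nat.pair (j.unpair.2.unpair.1 + 1) (max j.unpair.2.unpair.2 x))
    else if max j.unpair.2.unpair.2 x ≤ q.getD 0 then Nat.pair 2 j.unpair.2.unpair.1
    else Nat.pair 3 0

theorem primrec_sliceStep :
    Primrec fun z : (Option ℕ × Option ℕ × Option ℕ) × ℕ × ℕ × Bool =>
      sliceStep z.1.1 z.1.2.1 z.1.2.2 z.2.1 z.2.2.1 z.2.2.2 := by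
  let T := (Option ℕ × Option ℕ × Option ℕ) × ℕ × ℕ × Bool
  have ho : Primrec fun z : T => z.1.1 := Primrec.fst.comp Primrec.fst
  have hp : Primrec fun z : T => z.1.2.1 := Primrec.fst.comp (Primrec.snd.comp Primrec.fst)
  have hq : Primrec fun z : T => z.1.2.2 := Primrec.snd.comp (Primrec.snd.comp Primrec.fst)
  have hj : Primrec fun z : T => z.2.1 := Primrec.fst.comp Primrec.snd
  have hx : Primrec fun z : T => z.2.2.1 := Primrec.fst.comp (Primrec.snd.comp Primrec.snd)
  have hc : Primrec fun z : T => z.2.2.2 := Primrec.snd.comp (Primrec.snd.comp Primrec.snd)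
  have hj1 := primrec_unpair_fst.comp hj
  have hj2 := primrec_unpair_snd.comp hj
  have hj21 := primrec_unpair_fst.comp hj2
  have hm := Primrec.nat_max.comp (primrec_unpair_snd.comp hj2) hx
  have h0 : ∀ k, PrimrecPred fun z : T => z.2.1.unpair.1 = k :=
    fun k => Primrec.eq.comp hj1 (Primrec.const k)
  have h1 : ∀ k, PrimrecPred fun z : T => z.2.2.1 = k :=
    fun k => Primrec.eq.comp hx (Primrec.const k)
  refine Primrec.ite (h0 0) ?_ (Primrec.ite (h0 1) ?_ (Primrec.ite (h0 2) ?_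
    (Primrec.ite (h0 3) ?_ ?_)))
  · exact Primrec.ite (h1 0) (Primrec.const _) (Primrec.ite (h1 1) hj (Primrec.const _))
  · exact Primrec.ite (Primrec.eq.comp hc (Primrec.const true)) (Primrec.const _)
      (Primrec.ite (h1 0) (Primrec.const _) hj)
  · exact Primrec.ite ((primrecPred_ne_none.comp ho).and
      (Primrec.nat_lt.comp (primrec_getD_zero.comp ho) hx)) (Primrec.const _) hj
  · exact Primrec.ite (primrecPred_ne_none.comp hp) hj
      (Primrec₂.natPair.comp (Primrec.const 3) (Primrec.succ.comp hj2))
  · refine Primrec.ite (Primrec.eq.comp hq (Primrec.const none))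
      (Primrec₂.natPair.comp (Primrec.const 4)
        (Primrec₂.natPair.comp (Primrec.succ.comp hj21) hm))
      (Primrec.ite (Primrec.nat_le.comp hm (primrec_getD_zero.comp hq))
        (Primrec₂.natPair.comp (Primrec.const 2) hj21) (Primrec.const _))

namespace StagePair

variable (S : StagePair)

/-- One step of the history bounded engine inside column `e`. -/
def step (e j x : ℕ) (c : Bool) : ℕ :=
  sliceStep (S.fst e j.unpair.2) (S.snd e j.unpair.2) (S.fst e j.unpair.2.unpair.1) j x c

/-- The history bounded engine: it works in the column of the current datum, if there is one, and
restarts whenever the column changes. -/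
def engine (p : ℕ) (t c : Option ℕ) : ℕ :=
  Nat.pair (t.getD p).unpair.1 (S.step (t.getD p).unpair.1
    (if (t.getD p).unpair.1 = p.unpair.1 then p.unpair.2 else 0)
    (t.getD (Nat.pair 0 1)).unpair.2 c.isSome)

theorem engine_computable : EngineComputable S.engine := by
  have hp : Primrec fun z : ℕ × Option ℕ × Option ℕ => z.1 := Primrec.fst
  have ht : Primrec fun z : ℕ × Option ℕ × Option ℕ => z.2.1 := Primrec.fst.comp Primrec.snd
  have hc : Primrec fun z : ℕ × Option ℕ × Option ℕ => z.2.2.isSome :=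
    Primrec.option_isSome.comp (Primrec.snd.comp Primrec.snd)
  have he := primrec_unpair_fst.comp (Primrec.option_getD.comp ht hp)
  have hj := Primrec.ite (Primrec.eq.comp he (primrec_unpair_fst.comp hp))
    (primrec_unpair_snd.comp hp) (Primrec.const 0)
  have hx := primrec_unpair_snd.comp (Primrec.option_getD.comp ht (Primrec.const (Nat.pair 0 1)))
  have hk := primrec_unpair_snd.comp hj
  have hk1 := primrec_unpair_fst.comp hk
  have hs := primrec_sliceStep.to_comp.comp
    (((S.computable_fst.comp he.to_comp hk.to_comp).pair
      ((S.computable_snd.comp he.to_comp hk.to_comp).pair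
        (S.computable_fst.comp he.to_comp hk1.to_comp))).pair
      (hj.to_comp.pair (hx.to_comp.pair hc.to_comp)))
  exact Primrec₂.natPair.to_comp.comp he.to_comp hs

variable {e : ℕ}

theorem step_zero (x : ℕ) (c : Bool) : S.step e 0 x c =
    if x = 0 then Nat.pair 4 (Nat.pair 0 0) else if x = 1 then 0 else Nat.pair 1 0 := by
  simp [step, sliceStep]

theorem step_pos (x : ℕ) (c : Bool) : S.step e (Nat.pair 1 0) x c =
    if c = true then Nat.pair 3 0 else if x = 0 then Nat.pair 4 (Nat.pair 0 0) else Nat.pair 1 0 := by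
  simp [step, sliceStep]

theorem step_fst {k a : ℕ} (h : S.fst e k = some a) (x : ℕ) (c : Bool) :
    S.step e (Nat.pair 2 k) x c = if a < x then Nat.pair 3 0 else Nat.pair 2 k := by
  simp [step, sliceStep, h]

theorem step_snd (k x : ℕ) (c : Bool) : S.step e (Nat.pair 3 k) x c =
    if S.snd e k ≠ none then Nat.pair 3 k else Nat.pair 3 (k + 1) := by
  simp [step, sliceStep]

theorem step_search_none {t : ℕ} (h : S.fst e t = none) (m x : ℕ) (c : Bool) :
    S.step e (Nat.pair 4 (Nat.pair t m)) x c = Nat.pair 4 (Nat.pair (t + 1) (max m x)) := by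
  simp [step, sliceStep, h]

theorem step_search_some {t a : ℕ} (h : S.fst e t = some a) (m x : ℕ) (c : Bool) :
    S.step e (Nat.pair 4 (Nat.pair t m)) x c =
      if max m x ≤ a then Nat.pair 2 t else Nat.pair 3 0 := by
  simp [step, sliceStep, h]

theorem fst_eq_none {t t₀ a : ℕ} (h₀ : S.fst e t₀ = some a) (h : t ≠ t₀) : S.fst e t = none := by
  by_contra hn
  exact h (S.fst_unique e t t₀ (Option.isSome_iff_ne_none.2 hn) (by simp [h₀]))

theorem snd_eq_none {t t₀ v : ℕ} (h₀ : S.snd e t₀ = some v) (h : t ≠ t₀) : S.snd e t = none := by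
  by_contra hn
  exact h (S.snd_unique e t t₀ (Option.isSome_iff_ne_none.2 hn) (by simp [h₀]))

/-- From a search state the column engine reaches, unless it is diverted to the second kind of
search, the conjecture announced by the first stage function. -/
theorem exists_of_search {d J : ℕ → ℕ} {cs : ℕ → Bool} {t₀ a : ℕ} (h₀ : S.fst e t₀ = some a)
    (hJ : ∀ n, J (n + 1) = S.step e (J n) (d n) (cs n)) :
    ∀ k n t m, t + k = t₀ → J n = Nat.pair 4 (Nat.pair t m) →
      ∃ n' > n, J n' = Nat.pair 2 t₀ ∨ J n' = Nat.pair 3 0 := by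
  intro k
  induction k with
  | zero =>
    intro n t m ht hn
    obtain rfl : t = t₀ := ht
    have h := hJ n
    rw [hn, S.step_search_some h₀] at h
    refine ⟨n + 1, by omega, ?_⟩
    rw [h]
    split_ifs <;> simp
  | succ k ih =>
    intro n t m ht hn
    have h := hJ n
    rw [hn, S.step_search_none (S.fst_eq_none h₀ (by omega))] at h
    obtain ⟨n', hn', h'⟩ := ih (n + 1) (t + 1) _ (by omega) h
    exact ⟨n', by omega, h'⟩

theorem exists_of_second_search {d J : ℕ → ℕ} {cs : ℕ → Bool} {y₀ v : ℕ}
    (h₀ : S.snd e y₀ = some v) (hJ : ∀ n, J (n + 1) = S.step e (J n) (d n) (cs n)) :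
    ∀ k n y, y + k = y₀ → J n = Nat.pair 3 y → ∃ n', J n' = Nat.pair 3 y₀ := by
  intro k
  induction k with
  | zero =>
    intro n y hy hn
    exact ⟨n, by rw [hn]; simpa using hy⟩
  | succ k ih =>
    intro n y hy hn
    have h := hJ n
    rw [hn, S.step_snd, S.snd_eq_none h₀ (by omega), if_neg (by simp)] at h
    exact ih (n + 1) (y + 1) (by omega) h

theorem eq_of_fixed {d J : ℕ → ℕ} {cs : ℕ → Bool} {N j : ℕ}
    (hJ : ∀ n, J (n + 1) = S.step e (J n) (d n) (cs n)) (h0 : J N = j)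
    (hfix : ∀ n ≥ N, S.step e j (d n) (cs n) = j) : ∀ n ≥ N, J n = j := by
  intro n hn
  induction n, hn using Nat.le_induction with
  | base => exact h0
  | succ n hn ih => rw [hJ, ih, hfix n hn]

/-- Within a column, the engine converges to a conjecture for the target slice, provided
counterexamples are given to the conjecture of all positive numbers exactly when there is one
below a datum. -/
theorem column_converges {j₀ : ℕ} {d J : ℕ → ℕ} {cs : ℕ → Bool}
    (hd : ∀ n, d n ∈ S.slice e j₀) (hsurj : ∀ x ∈ S.slice e j₀, ∃ n, d n = x)
    (hJ0 : J 0 = 0) (hJ : ∀ n, J (n + 1) = S.step e (J n) (d n) (cs n))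
    (hcs : ∀ n, J n = Nat.pair 1 0 →
      (cs n = true ↔ ∃ m ≥ 1, m ∉ S.slice e j₀ ∧ ∃ i ≤ n, m < d i)) :
    ∃ N j, S.slice e j = S.slice e j₀ ∧ ∀ n ≥ N, J n = j := by
  rcases S.slice_cases e j₀ with rfl | ⟨t₀, a, rfl, ha⟩ | ⟨y₀, v, rfl, hv⟩ | hC
  · -- all positive numbers
    simp only [S.mem_slice_pos] at hd hsurj hcs
    have hns : ∀ n, J n = Nat.pair 1 0 → cs n = false := by
      intro n hn
      rw [← Bool.not_eq_true, hcs n hn]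
      rintro ⟨m, h1, h2, -⟩
      exact h2 h1
    have hstay : ∀ n, J n = Nat.pair 1 0 → J (n + 1) = Nat.pair 1 0 := by
      intro n hn
      have := hd n
      rw [hJ, hn, S.step_pos, hns n hn, if_neg (by simp), if_neg (by omega)]
    obtain ⟨N, hN⟩ := hsurj 2 (by omega)
    have hinv : ∀ n, J n = 0 ∨ J n = Nat.pair 1 0 := by
      intro n
      induction n with
      | zero => exact Or.inl hJ0
      | succ n ih =>
        rcases ih with h | h
        · have := hd n
          rw [hJ, h, S.step_zero, if_neg (by omega)]
          split_ifs <;> simp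
        · exact Or.inr (hstay n h)
    refine ⟨N + 1, Nat.pair 1 0, rfl, fun n hn => ?_⟩
    induction n, hn using Nat.le_induction with
    | base =>
      rcases hinv N with h | h
      · rw [hJ, h, S.step_zero, hN]; simp
      · exact hstay N h
    | succ n hn ih => exact hstay n ih
  · -- an initial segment
    have ha1 := S.fst_pos e t₀ a ha
    simp only [S.mem_slice_fst ha] at hd hsurj hcs
    have hns : ∀ n, J n = Nat.pair 1 0 → cs n = false := by
      intro n hn
      rw [← Bool.not_eq_true, hcs n hn]
      rintro ⟨m, h1, h2, i, -, h3⟩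
      have := hd i
      omega
    have hinv : ∀ n, J n = 0 ∨ J n = Nat.pair 1 0 ∨
        (∃ t m, t ≤ t₀ ∧ m ≤ a ∧ J n = Nat.pair 4 (Nat.pair t m)) ∨ J n = Nat.pair 2 t₀ := by
      intro n
      induction n with
      | zero => exact Or.inl hJ0
      | succ n ih =>
        have hdn := hd n
        rw [hJ]
        rcases ih with h | h | ⟨t, m, ht, hm, h⟩ | h
        · rw [h, S.step_zero]
          split_ifs
          · exact Or.inr (Or.inr (Or.inl ⟨0, 0, by omega, by omega, by simp⟩))
          · simp
          · simp
        · rw [h, S.step_pos, hns n h, if_neg (by simp)]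
          split_ifs
          · exact Or.inr (Or.inr (Or.inl ⟨0, 0, by omega, by omega, by simp⟩))
          · simp
        · rw [h]
          rcases eq_or_ne t t₀ with rfl | hne
          · rw [S.step_search_some ha, if_pos (by omega)]; simp
          · rw [S.step_search_none (S.fst_eq_none ha hne)]
            exact Or.inr (Or.inr (Or.inl ⟨t + 1, max m (d n), by omega, by omega, rfl⟩))
        · rw [h, S.step_fst ha, if_neg (by omega)]; simp
    obtain ⟨N, hN⟩ := hsurj 0 (by omega)
    have hreach : ∃ n, (∃ t m, t ≤ t₀ ∧ J n = Nat.pair 4 (Nat.pair t m)) ∨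
        J n = Nat.pair 2 t₀ := by
      rcases hinv N with h | h | ⟨t, m, ht, -, h⟩ | h
      · exact ⟨N + 1, Or.inl ⟨0, 0, by omega, by rw [hJ, h, S.step_zero, hN]; simp⟩⟩
      · exact ⟨N + 1, Or.inl ⟨0, 0, by omega, by rw [hJ, h, S.step_pos, hN, hns N h]; simp⟩⟩
      · exact ⟨N, Or.inl ⟨t, m, ht, h⟩⟩
      · exact ⟨N, Or.inr h⟩
    have hreach' : ∃ n, J n = Nat.pair 2 t₀ := by
      obtain ⟨n, ⟨t, m, ht, h⟩ | h⟩ := hreach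
      · obtain ⟨n', -, h' | h'⟩ := S.exists_of_search ha hJ (t₀ - t) n t m (by omega) h
        · exact ⟨n', h'⟩
        · exfalso
          rcases hinv n' with h'' | h'' | ⟨t, m, -, -, h''⟩ | h'' <;> rw [h'] at h'' <;>
            simpa using congrArg (fun j => j.unpair.1) h''
      · exact ⟨n, h⟩
    obtain ⟨n, hn⟩ := hreach'
    refine ⟨n, Nat.pair 2 t₀, rfl, S.eq_of_fixed hJ hn fun m _ => ?_⟩
    have := hd m
    rw [S.step_fst ha, if_neg (by omega)]
  · -- a set with gaps
    obtain ⟨hn1, t₀, ha⟩ := S.snd_spec e y₀ v hv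
    have hmem : ∀ x, x ∈ S.slice e (Nat.pair 3 y₀) ↔ _ := fun x => S.mem_slice_snd hv
    simp only [hmem] at hd hsurj hcs
    set a := v.unpair.1
    set n₁ := v.unpair.2
    have ha1 := S.fst_pos e t₀ a ha
    obtain ⟨M, hM1, hM2, hMa⟩ : ∃ M, M ∈ gapSet a n₁ ∧ M - 1 ∉ gapSet a n₁ ∧ a + 5 ≤ M := by
      refine ⟨a + 4 * ((n₁ - 1) / 2) + 5, ?_, ?_, by omega⟩ <;> rw [mem_gapSet] <;> omega
    have hgift : ∀ n, J n = Nat.pair 1 0 → (∃ i ≤ n, d i = M) → cs n = true := by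
      rintro n h ⟨i, hi, hiM⟩
      exact (hcs n h).2 ⟨M - 1, by omega, hM2, i, hi, by omega⟩
    have hinv : ∀ n, (J n = 0 ∧ ¬ ∃ i < n, d i = M) ∨ J n = Nat.pair 1 0 ∨
        (∃ t m, t ≤ t₀ ∧ J n = Nat.pair 4 (Nat.pair t m) ∧ ((∃ i < n, d i = M) → M ≤ m)) ∨
        (J n = Nat.pair 2 t₀ ∧ ¬ ∃ i < n, d i = M) ∨ ∃ y ≤ y₀, J n = Nat.pair 3 y := by
      intro n
      induction n with
      | zero => exact Or.inl ⟨hJ0, by simp⟩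
      | succ n ih =>
        have hshow : (∃ i < n + 1, d i = M) → (∃ i < n, d i = M) ∨ d n = M := by
          rintro ⟨i, hi, h⟩
          rcases Nat.lt_succ_iff_lt_or_eq.1 hi with h' | rfl
          · exact Or.inl ⟨i, h', h⟩
          · exact Or.inr h
        have hB : ∀ y ≤ y₀, J (n + 1) = Nat.pair 3 y → ∃ y ≤ y₀, J (n + 1) = Nat.pair 3 y :=
          fun y hy h => ⟨y, hy, h⟩
        have hstep := hJ n
        rcases ih with ⟨h, hs⟩ | h | ⟨t, m, ht, h, hs⟩ | ⟨h, hs⟩ | ⟨y, hy, h⟩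
        · rw [h, S.step_zero] at hstep
          split_ifs at hstep with h0 h1
          · refine Or.inr (Or.inr (Or.inl ⟨0, 0, by omega, hstep, fun h' => ?_⟩))
            rcases hshow h' with h' | h'
            · exact absurd h' hs
            · omega
          · refine Or.inl ⟨hstep, fun h' => ?_⟩
            rcases hshow h' with h' | h'
            · exact absurd h' hs
            · omega
          · exact Or.inr (Or.inl hstep)
        · rw [h, S.step_pos] at hstep
          split_ifs at hstep with hc h0
          · exact Or.inr (Or.inr (Or.inr (Or.inr (hB 0 (by omega) hstep))))
          · refine Or.inr (Or.inr (Or.inl ⟨0, 0, by omega, hstep, fun h' => ?_⟩))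
            obtain ⟨i, hi, h''⟩ := h'
            exact absurd (hgift n h ⟨i, by omega, h''⟩) hc
          · exact Or.inr (Or.inl hstep)
        · rcases eq_or_ne t t₀ with rfl | hne
          · rw [h, S.step_search_some ha] at hstep
            split_ifs at hstep with hle
            · refine Or.inr (Or.inr (Or.inr (Or.inl ⟨hstep, fun h' => ?_⟩)))
              rcases hshow h' with h' | h'
              · have := hs h'
                omega
              · omega
            · exact Or.inr (Or.inr (Or.inr (Or.inr (hB 0 (by omega) hstep))))
          · rw [h, S.step_search_none (S.fst_eq_none ha hne)] at hstep
            refine Or.inr (Or.inr (Or.inl ⟨t + 1, max m (d n), by omega, hstep, fun h' => ?_⟩))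
            rcases hshow h' with h' | h'
            · have := hs h'
              omega
            · omega
        · rw [h, S.step_fst ha] at hstep
          split_ifs at hstep with hlt
          · exact Or.inr (Or.inr (Or.inr (Or.inr (hB 0 (by omega) hstep))))
          · refine Or.inr (Or.inr (Or.inr (Or.inl ⟨hstep, fun h' => ?_⟩)))
            rcases hshow h' with h' | h'
            · exact absurd h' hs
            · omega
        · rw [h, S.step_snd] at hstep
          rcases eq_or_ne y y₀ with rfl | hne
          · rw [hv, if_pos (by simp)] at hstep
            exact Or.inr (Or.inr (Or.inr (Or.inr (hB y hy hstep))))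
          · rw [S.snd_eq_none hv hne, if_neg (by simp)] at hstep
            exact Or.inr (Or.inr (Or.inr (Or.inr (hB (y + 1) (by omega) hstep))))
    obtain ⟨N, hN⟩ := hsurj M hM1
    have hshown : ∀ n > N, ∃ i < n, d i = M := fun n hn => ⟨N, hn, hN⟩
    have hreach : ∃ n, ∃ y ≤ y₀, J n = Nat.pair 3 y := by
      rcases hinv (N + 1) with ⟨-, h⟩ | h | ⟨t, m, ht, h, -⟩ | ⟨-, h⟩ | h
      · exact absurd (hshown _ (by omega)) h
      · exact ⟨N + 2, 0, by omega, by
          rw [hJ, h, S.step_pos, if_pos (hgift _ h ⟨N, by omega, hN⟩)]⟩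
      · obtain ⟨n', hn', h' | h'⟩ := S.exists_of_search ha hJ (t₀ - t) (N + 1) t m (by omega) h
        · exfalso
          rcases hinv n' with ⟨-, h⟩ | h'' | ⟨t, m, -, h'', -⟩ | ⟨-, h⟩ | ⟨y, -, h''⟩
          · exact h (hshown _ (by omega))
          · rw [h'] at h''; simpa using congrArg (fun j => j.unpair.1) h''
          · rw [h'] at h''; simpa using congrArg (fun j => j.unpair.1) h''
          · exact h (hshown _ (by omega))
          · rw [h'] at h''; simpa using congrArg (fun j => j.unpair.1) h''
        · exact ⟨n', 0, by omega, h'⟩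
      · exact absurd (hshown _ (by omega)) h
      · exact ⟨N + 1, h⟩
    obtain ⟨n, y, hy, h⟩ := hreach
    obtain ⟨n', h'⟩ := S.exists_of_second_search hv hJ (y₀ - y) n y (by omega) h
    refine ⟨n', Nat.pair 3 y₀, rfl, S.eq_of_fixed hJ h' fun m _ => ?_⟩
    rw [S.step_snd, hv]; simp
  · -- the slice `{1}`
    refine ⟨0, 0, ?_, ?_⟩
    · ext x
      rw [hC, mem_slice]
      simp; intro h
      exact absurd h (by decide)
    · refine S.eq_of_fixed hJ hJ0 fun n _ => ?_
      rw [S.step_zero, (hC _).1 (hd n)]; simp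

end StagePair

namespace StagePair

variable (S : StagePair)

/-- The sequence of conjectures of the engine inside column `e`. -/
def column (e : ℕ) (τ cex : ℕ → Option ℕ) (n : ℕ) : ℕ :=
  n.rec 0 fun k j => S.step e j ((τ k).getD (Nat.pair 0 1)).unpair.2 (cex k).isSome

theorem column_succ (e : ℕ) (τ cex : ℕ → Option ℕ) (n : ℕ) :
    S.column e τ cex (n + 1) = S.step e (S.column e τ cex n)
      ((τ n).getD (Nat.pair 0 1)).unpair.2 (cex n).isSome :=
  rfl

/-- On data from column `e`, the engine waits for the first datum and is then determined by the
conjectures inside the column. -/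
theorem cand_engine {e : ℕ} {τ cex : ℕ → Option ℕ} (hτ : ∀ n v, τ n = some v → v.unpair.1 = e)
    (n : ℕ) : cand S.engine 0 τ cex n = Nat.pair e (S.column e τ cex n) ∨
      (cand S.engine 0 τ cex n = 0 ∧ S.column e τ cex n = 0 ∧ ∀ i < n, τ i = none) := by
  induction n with
  | zero => exact Or.inr ⟨rfl, rfl, by simp⟩
  | succ n ih =>
    rw [cand, column_succ]
    cases h : τ n with
    | some v =>
      have hv := hτ n v h
      left
      rcases ih with h' | ⟨h', h'', -⟩ <;> rw [h']
      · simp [engine, hv]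
      · simp [engine, hv, h'']
    | none =>
      rcases ih with h' | ⟨h', h'', h3⟩ <;> rw [h']
      · left; simp [engine]
      · right
        have h0 : Nat.pair 0 0 = 0 := by decide
        refine ⟨?_, ?_, fun i hi => ?_⟩
        · simp [engine, step_zero, h0]
        · simp [h'', step_zero]
        · rcases Nat.lt_succ_iff_lt_or_eq.1 hi with h' | rfl
          · exact h3 i h'
          · exact h

theorem family_inHCEGIS : InHCEGIS S.family := by
  refine ⟨S.engine, 0, S.engine_computable, fun i₀ τ hτ cex hcex => ?_⟩
  set e := i₀.unpair.1 with he
  set j₀ := i₀.unpair.2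
  set d : ℕ → ℕ := fun n => ((τ n).getD (Nat.pair 0 1)).unpair.2 with hd
  have hmem : ∀ n v, τ n = some v → v ∈ S.family i₀ := by
    intro n v h; rw [← hτ]; exact ⟨n, h⟩
  have hτe : ∀ n v, τ n = some v → v.unpair.1 = e := fun n v h => (hmem n v h).1
  have hcand := S.cand_engine (cex := cex) hτe
  have hpair : Nat.pair e 1 ∈ S.family i₀ := S.pair_mem_family.2 ⟨rfl, S.one_mem_slice _ _⟩
  obtain ⟨N, j, hj, hN⟩ := S.column_converges (e := e) (j₀ := j₀) (d := d)
    (J := S.column e τ cex) (cs := fun n => (cex n).isSome) (by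
      intro n
      cases h : τ n with
      | some v => simpa [hd, h] using (hmem n v h).2
      | none => simpa [hd, h] using S.one_mem_slice _ _) (by
      intro x hx
      have : Nat.pair e x ∈ S.family i₀ := S.pair_mem_family.2 ⟨rfl, hx⟩
      rw [← hτ] at this
      obtain ⟨n, hn⟩ := this
      exact ⟨n, by simp [hd, hn]⟩) rfl (fun n => rfl) (by
      intro n hn
      have hc : cand S.engine 0 τ cex n = Nat.pair e (Nat.pair 1 0) := by
        rcases hcand n with h | ⟨-, h, -⟩
        · rw [h, hn]
        · rw [h] at hn; exact absurd hn (by decide)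
      obtain ⟨h1, h2⟩ := hcex n
      have hiff : (∃ m, m ∈ S.family (cand S.engine 0 τ cex n) \ S.family i₀ ∧
          ∃ i ≤ n, ∃ v, τ i = some v ∧ m < v) ↔
          ∃ m ≥ 1, m ∉ S.slice e j₀ ∧ ∃ i ≤ n, m < d i := by
        rw [hc]
        constructor
        · rintro ⟨m, ⟨hm1, hm2⟩, i, hi, v, hv, hmv⟩
          rw [mem_family] at hm1
          simp only [Nat.unpair_pair, mem_slice_pos] at hm1
          refine ⟨m.unpair.2, hm1.2, fun h => hm2 ⟨hm1.1, h⟩, i, hi, ?_⟩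
          have hve := hτe i v hv
          simp only [hd, hv, Option.getD_some]
          rw [← Nat.pair_unpair m, ← Nat.pair_unpair v, hm1.1, hve] at hmv
          by_contra! hle
          have := (strictMono_nat_of_lt_succ (f := Nat.pair e)
            (fun k => Nat.pair_lt_pair_right e (Nat.lt_succ_self k))).monotone hle
          omega
        · rintro ⟨m, hm1, hm2, i, hi, hlt⟩
          refine ⟨Nat.pair e m, ⟨S.pair_mem_family.2 ?_, fun h => hm2 (S.pair_mem_family.1 h).2⟩,
            i, hi, ?_⟩
          · simpa [mem_slice_pos] using hm1
          · cases hv : τ i with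
            | none => simp [hd, hv] at hlt; omega
            | some v =>
              refine ⟨v, rfl, ?_⟩
              rw [← Nat.pair_unpair v, hτe i v hv]
              apply Nat.pair_lt_pair_right
              simpa [hd, hv] using hlt
      rw [← hiff]
      constructor
      · intro h
        by_contra h'
        rw [h2 h'] at h
        simp at h
      · intro h
        obtain ⟨m, hm, -⟩ := h1 h
        simp [hm])
  rw [← hτ] at hpair
  obtain ⟨K, hK⟩ := hpair
  refine ⟨max N (K + 1), Nat.pair e j, ?_, fun n hn => ?_⟩
  · have hj' : S.slice i₀.unpair.1 j = S.slice i₀.unpair.1 i₀.unpair.2 := hj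
    ext v; simp [mem_family, he, hj']
  · rcases hcand n with h | ⟨-, -, h⟩
    · rw [h, hN n (by omega)]
    · have := h K (by omega)
      rw [hK] at this
      cases this

end StagePair

/-- The counterexample answered to the conjecture `q` in the simulations for column `e`. -/
def cexRule (e w q : ℕ) : Option ℕ :=
  if q = Nat.pair e (Nat.pair 1 0) then some (Nat.pair e w)
  else if q.unpair.1 = e then none else some (Nat.pair q.unpair.1 1)

/-- The interleaving of `a + 5, a + 9, a + 13, …` and `1, 2, 3, …`. -/
def gapData (a n : ℕ) : ℕ := if n % 2 = 0 then a + 2 * n + 5 else (n + 1) / 2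

/-- The data shown in the three kinds of simulation. -/
def simData (i a n : ℕ) : ℕ := if i = 0 then n + 1 else if i = 1 then gapData a n else n % (a + 1)

/-- One step of the simulation, for column `e`, of the engine coded by `e.unpair.1`. -/
def simStep (e w i a n q : ℕ) : Part ℕ :=
  (Denumerable.ofNat Nat.Partrec.Code e.unpair.1).eval
    (Encodable.encode (q, some (Nat.pair e (simData i a n)), cexRule e w q))

theorem primrec_cexRule : Primrec fun z : ℕ × ℕ × ℕ => cexRule z.1 z.2.1 z.2.2 := by
  have he : Primrec fun z : ℕ × ℕ × ℕ => z.1 := Primrec.fst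
  have hw : Primrec fun z : ℕ × ℕ × ℕ => z.2.1 := Primrec.fst.comp Primrec.snd
  have hq : Primrec fun z : ℕ × ℕ × ℕ => z.2.2 := Primrec.snd.comp Primrec.snd
  have hq1 := primrec_unpair_fst.comp hq
  exact Primrec.ite (Primrec.eq.comp hq (Primrec₂.natPair.comp he (Primrec.const _)))
    (Primrec.option_some.comp (Primrec₂.natPair.comp he hw))
    (Primrec.ite (Primrec.eq.comp hq1 he) (Primrec.const none)
      (Primrec.option_some.comp (Primrec₂.natPair.comp hq1 (Primrec.const 1))))

theorem primrec_simData : Primrec fun z : ℕ × ℕ × ℕ => simData z.1 z.2.1 z.2.2 := by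
  have hi : Primrec fun z : ℕ × ℕ × ℕ => z.1 := Primrec.fst
  have ha : Primrec fun z : ℕ × ℕ × ℕ => z.2.1 := Primrec.fst.comp Primrec.snd
  have hn : Primrec fun z : ℕ × ℕ × ℕ => z.2.2 := Primrec.snd.comp Primrec.snd
  refine Primrec.ite (Primrec.eq.comp hi (Primrec.const 0)) (Primrec.succ.comp hn)
    (Primrec.ite (Primrec.eq.comp hi (Primrec.const 1)) (Primrec.ite (Primrec.eq.comp
      (Primrec.nat_mod.comp hn (Primrec.const 2)) (Primrec.const 0)) ?_ ?_)
      (Primrec.nat_mod.comp hn (Primrec.succ.comp ha)))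
  · exact Primrec.nat_add.comp (Primrec.nat_add.comp ha
      (Primrec.nat_mul.comp (Primrec.const 2) hn)) (Primrec.const 5)
  · exact Primrec.nat_div.comp (Primrec.succ.comp hn) (Primrec.const 2)

theorem partrec_simStep {α : Type} [Primcodable α] {e w a : α → ℕ} (i : ℕ) (he : Computable e)
    (hw : Computable w) (ha : Computable a) :
    Partrec fun z : α × ℕ × ℕ => simStep (e z.1) (w z.1) i (a z.1) z.2.1 z.2.2 := by
  have he' : Computable fun z : α × ℕ × ℕ => e z.1 := he.comp Computable.fst
  have hw' : Computable fun z : α × ℕ × ℕ => w z.1 := hw.comp Computable.fst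
  have ha' : Computable fun z : α × ℕ × ℕ => a z.1 := ha.comp Computable.fst
  have hn : Computable fun z : α × ℕ × ℕ => z.2.1 := Computable.fst.comp Computable.snd
  have hq : Computable fun z : α × ℕ × ℕ => z.2.2 := Computable.snd.comp Computable.snd
  refine Nat.Partrec.Code.eval_part.comp
    ((Computable.ofNat _).comp (primrec_unpair_fst.to_comp.comp he')) ?_
  refine Computable.encode.comp (hq.pair (Computable.pair ?_ ?_))
  · exact Computable.option_some.comp (Primrec₂.natPair.to_comp.comp he'
      (primrec_simData.to_comp.comp ((Computable.const i).pair (ha'.pair hn))))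
  · exact primrec_cexRule.to_comp.comp (he'.pair (hw'.pair hq))

/-- Run the engine of column `e` on `1, 2, 3, …` until it conjectures all positive numbers. -/
def firstSim (e : ℕ) : Part (ℕ × ℕ) :=
  haltPart (simStep e 0 0 0) e.unpair.2 fun q => decide (q = Nat.pair e (Nat.pair 1 0))

/-- Run the engine of column `e` on `gapData a` until it conjectures all positive numbers or the
initial segment with stage `k`. -/
def secondSim (e k a : ℕ) : Part (ℕ × ℕ) :=
  haltPart (simStep e 0 1 a) e.unpair.2 fun q =>
    decide (q = Nat.pair e (Nat.pair 1 0) ∨ q = Nat.pair e (Nat.pair 2 k))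

/-- Run the engine of column `e` from the conjecture `q₀` on the numbers up to `a`, repeated
periodically, until it conjectures the initial segment with stage `k`. -/
def thirdSim (e k a n q₀ : ℕ) : Part (ℕ × ℕ) :=
  haltPart (simStep e (a + 4 * n + 4) 2 a) q₀ fun q => decide (q = Nat.pair e (Nat.pair 2 k))

theorem partrec_firstSim : Partrec firstSim := by
  refine partrec_haltPart (f := fun e => simStep e 0 0 0) (q₀ := fun e => e.unpair.2)
    (halted := fun e q => decide (q = Nat.pair e (Nat.pair 1 0)))
    (partrec_simStep (e := fun e => e) (w := fun _ => 0) (a := fun _ => 0) 0 Computable.id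
      (Computable.const 0) (Computable.const 0)) primrec_unpair_snd.to_comp ?_
  have h : PrimrecPred fun z : ℕ × ℕ => z.2 = Nat.pair z.1 (Nat.pair 1 0) :=
    Primrec.eq.comp Primrec.snd (Primrec₂.natPair.comp Primrec.fst (Primrec.const _))
  exact h.decide.to_comp

theorem partrec_secondSim : Partrec fun z : ℕ × ℕ × ℕ => secondSim z.1 z.2.1 z.2.2 := by
  refine partrec_haltPart (f := fun z : ℕ × ℕ × ℕ => simStep z.1 0 1 z.2.2)
    (q₀ := fun z => z.1.unpair.2) (halted := fun z q =>
      decide (q = Nat.pair z.1 (Nat.pair 1 0) ∨ q = Nat.pair z.1 (Nat.pair 2 z.2.1)))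
    (partrec_simStep (e := fun z : ℕ × ℕ × ℕ => z.1) (w := fun _ => 0) (a := fun z => z.2.2) 1
      Computable.fst (Computable.const 0) (Computable.snd.comp Computable.snd))
    (primrec_unpair_snd.to_comp.comp Computable.fst) ?_
  have he : Primrec fun z : (ℕ × ℕ × ℕ) × ℕ => z.1.1 := Primrec.fst.comp Primrec.fst
  have hk : Primrec fun z : (ℕ × ℕ × ℕ) × ℕ => z.1.2.1 :=
    Primrec.fst.comp (Primrec.snd.comp Primrec.fst)
  have h : PrimrecPred fun z : (ℕ × ℕ × ℕ) × ℕ =>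
      z.2 = Nat.pair z.1.1 (Nat.pair 1 0) ∨ z.2 = Nat.pair z.1.1 (Nat.pair 2 z.1.2.1) :=
    (Primrec.eq.comp Primrec.snd (Primrec₂.natPair.comp he (Primrec.const _))).or
      (Primrec.eq.comp Primrec.snd (Primrec₂.natPair.comp he
        (Primrec₂.natPair.comp (Primrec.const 2) hk)))
  exact h.decide.to_comp

theorem partrec_thirdSim :
    Partrec fun z : (ℕ × ℕ × ℕ) × ℕ × ℕ => thirdSim z.1.1 z.1.2.1 z.1.2.2 z.2.1 z.2.2 := by
  have he : Primrec fun z : (ℕ × ℕ × ℕ) × ℕ × ℕ => z.1.1 := Primrec.fst.comp Primrec.fst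
  have hk : Primrec fun z : (ℕ × ℕ × ℕ) × ℕ × ℕ => z.1.2.1 :=
    Primrec.fst.comp (Primrec.snd.comp Primrec.fst)
  have ha : Primrec fun z : (ℕ × ℕ × ℕ) × ℕ × ℕ => z.1.2.2 :=
    Primrec.snd.comp (Primrec.snd.comp Primrec.fst)
  have hn : Primrec fun z : (ℕ × ℕ × ℕ) × ℕ × ℕ => z.2.1 := Primrec.fst.comp Primrec.snd
  have hw : Primrec fun z : (ℕ × ℕ × ℕ) × ℕ × ℕ => z.1.2.2 + 4 * z.2.1 + 4 :=
    Primrec.nat_add.comp (Primrec.nat_add.comp ha (Primrec.nat_mul.comp (Primrec.const 4) hn))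
      (Primrec.const 4)
  refine partrec_haltPart
    (f := fun z : (ℕ × ℕ × ℕ) × ℕ × ℕ => simStep z.1.1 (z.1.2.2 + 4 * z.2.1 + 4) 2 z.1.2.2)
    (q₀ := fun z => z.2.2) (halted := fun z q => decide (q = Nat.pair z.1.1 (Nat.pair 2 z.1.2.1)))
    (partrec_simStep (e := fun z : (ℕ × ℕ × ℕ) × ℕ × ℕ => z.1.1)
      (w := fun z => z.1.2.2 + 4 * z.2.1 + 4) (a := fun z => z.1.2.2) 2
      he.to_comp hw.to_comp ha.to_comp) (Computable.snd.comp Computable.snd) ?_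
  have h : PrimrecPred fun z : ((ℕ × ℕ × ℕ) × ℕ × ℕ) × ℕ =>
      z.2 = Nat.pair z.1.1.1 (Nat.pair 2 z.1.1.2.1) :=
    Primrec.eq.comp Primrec.snd (Primrec₂.natPair.comp (he.comp Primrec.fst)
        (Primrec₂.natPair.comp (Primrec.const 2) (hk.comp Primrec.fst)))
  exact h.decide.to_comp

theorem unpair_snd_lt_pair_pair (e t k : ℕ) (ht : 1 ≤ t) :
    e.unpair.2 < Nat.pair e (Nat.pair t k) := by
  have h1 := Nat.unpair_right_le e
  have h2 : e < Nat.pair e (Nat.pair t k) := by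
    have h3 := Nat.left_le_pair t k
    have h4 := Nat.left_le_pair e 0
    have h5 := (strictMono_nat_of_lt_succ (f := Nat.pair e)
      (fun k => Nat.pair_lt_pair_right e (Nat.lt_succ_self k))) (show 0 < Nat.pair t k by omega)
    omega
  omega

theorem secondSim_pos {e k a : ℕ} {r : ℕ × ℕ} (hr : r ∈ secondSim e k a) : 1 ≤ r.2 := by
  refine haltPart_pos hr ?_
  have h1 := unpair_snd_lt_pair_pair e 1 0 le_rfl
  have h2 := unpair_snd_lt_pair_pair e 2 k (by omega)
  rw [decide_eq_false_iff_not]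
  omega

/-- The second and third simulation, run with a bound announced by a stage function; the result
contains the bound and the length of the second simulation. -/
def secondStage (F : ℕ → ℕ → Option ℕ) (z : ℕ) : Part ℕ :=
  (F z.unpair.1 z.unpair.2 : Part ℕ).bind fun a =>
    (secondSim z.unpair.1 z.unpair.2 a).bind fun r =>
      (thirdSim z.unpair.1 z.unpair.2 a r.2 r.1).map fun _ => Nat.pair a r.2

theorem mem_secondStage {F : ℕ → ℕ → Option ℕ} {z u : ℕ} : u ∈ secondStage F z ↔
    ∃ a, F z.unpair.1 z.unpair.2 = some a ∧ ∃ r ∈ secondSim z.unpair.1 z.unpair.2 a,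
      ∃ s, s ∈ thirdSim z.unpair.1 z.unpair.2 a r.2 r.1 ∧ Nat.pair a r.2 = u := by
  simp only [secondStage, Part.mem_bind_iff, Part.mem_map_iff, Part.mem_ofOption, Option.mem_def]

theorem partrec_secondStage {F : ℕ → ℕ → Option ℕ} (hF : Computable₂ F) :
    Partrec (secondStage F) := by
  have hz : Primrec fun y : (ℕ × ℕ) × ℕ × ℕ => y.1.1 := Primrec.fst.comp Primrec.fst
  have ha : Primrec fun y : (ℕ × ℕ) × ℕ × ℕ => y.1.2 := Primrec.snd.comp Primrec.fst
  have hn : Primrec fun y : (ℕ × ℕ) × ℕ × ℕ => y.2.2 := Primrec.snd.comp Primrec.snd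
  have h1 : Partrec fun z : ℕ => (F z.unpair.1 z.unpair.2 : Part ℕ) :=
    Computable.ofOption (hF.comp primrec_unpair_fst.to_comp primrec_unpair_snd.to_comp)
  have h2 : Partrec₂ fun z a : ℕ => secondSim z.unpair.1 z.unpair.2 a :=
    Partrec.comp (g := fun y : ℕ × ℕ => (y.1.unpair.1, y.1.unpair.2, y.2)) partrec_secondSim
      (Primrec.to_comp (Primrec.pair (primrec_unpair_fst.comp Primrec.fst)
        (Primrec.pair (primrec_unpair_snd.comp Primrec.fst) Primrec.snd)))
  have h3 : Partrec₂ fun (y : ℕ × ℕ) (r : ℕ × ℕ) =>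
      thirdSim y.1.unpair.1 y.1.unpair.2 y.2 r.2 r.1 :=
    Partrec.comp (g := fun y : (ℕ × ℕ) × ℕ × ℕ =>
        ((y.1.1.unpair.1, y.1.1.unpair.2, y.1.2), y.2.2, y.2.1)) partrec_thirdSim
      (Primrec.to_comp (Primrec.pair (Primrec.pair (primrec_unpair_fst.comp hz)
        (Primrec.pair (primrec_unpair_snd.comp hz) ha))
        (Primrec.pair hn (Primrec.fst.comp Primrec.snd))))
  have h4 : Computable₂ fun (y : (ℕ × ℕ) × ℕ × ℕ) (_ : ℕ × ℕ) => Nat.pair y.1.2 y.2.2 :=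
    Primrec.to_comp (Primrec₂.natPair.comp (ha.comp Primrec.fst) (hn.comp Primrec.fst))
  exact h1.bind (h2.bind (h3.map h4))

/-- There are stage functions recording the outcomes of the three simulations. -/
theorem exists_stagePair : ∃ S : StagePair,
    (∀ e k a, S.fst e k = some a → ∃ r ∈ firstSim e, a = r.2 + 1) ∧
    (∀ e, (firstSim e).Dom → ∃ k a, S.fst e k = some a) ∧
    (∀ e k v, S.snd e k = some v → ∃ t a, S.fst e t = some a ∧ ∃ r ∈ secondSim e t a,
      (thirdSim e t a r.2 r.1).Dom ∧ v = Nat.pair a r.2) ∧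
    (∀ e t a r, S.fst e t = some a → r ∈ secondSim e t a → (thirdSim e t a r.2 r.1).Dom →
      ∃ k v, S.snd e k = some v) := by
  have hp1 : Partrec fun e => (firstSim e).map fun r => r.2 + 1 :=
    Partrec.map partrec_firstSim
      (Primrec.to_comp (Primrec.succ.comp (Primrec.snd.comp Primrec.snd)))
  obtain ⟨F, hFc, hf1, hf2, hf3⟩ := exists_stage_function hp1
  have hF1 : ∀ e k a, F e k = some a → ∃ r ∈ firstSim e, a = r.2 + 1 := by
    intro e k a h
    have h1 := hf1 e k a h
    simp only [Part.mem_map_iff] at h1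
    obtain ⟨r, hr, rfl⟩ := h1
    exact ⟨r, hr, rfl⟩
  obtain ⟨g, hgc, hg1, hg2, hg3⟩ := exists_stage_function (partrec_secondStage hFc)
  set G : ℕ → ℕ → Option ℕ := fun e k => g (Nat.pair e k.unpair.1) k.unpair.2 with hG
  have hGc : Computable₂ G :=
    hgc.comp (Primrec.to_comp (Primrec₂.natPair.comp Primrec.fst
      (primrec_unpair_fst.comp Primrec.snd))) (Primrec.to_comp
        (primrec_unpair_snd.comp Primrec.snd))
  have hG1 : ∀ e k v, G e k = some v → ∃ a, F e k.unpair.1 = some a ∧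
      ∃ r ∈ secondSim e k.unpair.1 a, (thirdSim e k.unpair.1 a r.2 r.1).Dom ∧
        v = Nat.pair a r.2 := by
    intro e k v h
    have h1 := hg1 _ _ v h
    simp only [mem_secondStage, Nat.unpair_pair] at h1
    obtain ⟨a, ha, r, hr, s, hs, rfl⟩ := h1
    exact ⟨a, ha, r, hr, Part.dom_iff_mem.2 ⟨s, hs⟩, rfl⟩
  refine ⟨⟨F, G, hFc, hGc, hf3, ?_, ?_, ?_⟩, hF1, ?_, ?_, ?_⟩
  · intro e k k' h h'
    obtain ⟨v, hv⟩ := Option.isSome_iff_exists.1 h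
    obtain ⟨v', hv'⟩ := Option.isSome_iff_exists.1 h'
    obtain ⟨a, ha, -⟩ := hG1 e k v hv
    obtain ⟨a', ha', -⟩ := hG1 e k' v' hv'
    have h1 : k.unpair.1 = k'.unpair.1 := hf3 e _ _ (by rw [ha]; rfl) (by rw [ha']; rfl)
    simp only [hG, ← h1] at h h'
    rw [← Nat.pair_unpair k, ← Nat.pair_unpair k', ← h1, hg3 _ _ _ h h']
  · intro e k a h
    obtain ⟨r, -, rfl⟩ := hF1 e k a h
    omega
  · intro e k v h
    obtain ⟨a, ha, r, hr, -, rfl⟩ := hG1 e k v h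
    simp only [Nat.unpair_pair]
    exact ⟨secondSim_pos hr, _, ha⟩
  · intro e he
    obtain ⟨k, hk⟩ := hf2 e he
    exact ⟨k, Option.isSome_iff_exists.1 hk⟩
  · intro e k v h
    obtain ⟨a, ha, h'⟩ := hG1 e k v h
    exact ⟨_, a, ha, h'⟩
  · intro e t a r ha hr hs
    obtain ⟨k, hk⟩ := hg2 (Nat.pair e t) (by
      obtain ⟨s, hs⟩ := Part.dom_iff_mem.1 hs
      rw [Part.dom_iff_mem]
      refine ⟨Nat.pair a r.2, ?_⟩
      simp only [mem_secondStage, Nat.unpair_pair]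
      exact ⟨a, ha, r, hr, s, hs, rfl⟩)
    refine ⟨Nat.pair t k, ?_⟩
    rw [← Option.isSome_iff_exists]
    simpa [hG] using hk

theorem mem_gapSet_iff_gapData {a n x : ℕ} :
    x ∈ gapSet a n ↔ x ≤ a ∨ ∃ m < n, gapData a m = x := by
  rw [mem_gapSet]
  constructor
  · rintro (h | h | h)
    · exact Or.inl h
    · refine Or.inr ⟨2 * x - 1, by omega, ?_⟩
      rw [gapData, if_neg (by omega)]; omega
    · refine Or.inr ⟨2 * ((x - (a + 5)) / 4), by omega, ?_⟩
      rw [gapData, if_pos (by omega)]; omega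
  · rintro (h | ⟨m, hm, rfl⟩)
    · exact Or.inl h
    · rw [gapData]
      split_ifs <;> omega

theorem exists_gapData_eq {a x : ℕ} : (∃ n, gapData a n = x) ↔ 1 ≤ x := by
  constructor
  · rintro ⟨n, rfl⟩
    rw [gapData]
    split_ifs <;> omega
  · intro h
    refine ⟨2 * x - 1, ?_⟩
    rw [gapData, if_neg (by omega)]; omega

theorem exists_mod_eq {a x : ℕ} : (∃ n, n % (a + 1) = x) ↔ x ≤ a := by
  constructor
  · rintro ⟨n, rfl⟩
    exact Nat.lt_succ_iff.1 (Nat.mod_lt _ (by omega))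
  · intro h
    exact ⟨x, Nat.mod_eq_of_lt (by omega)⟩

/-- The conjectures of an engine started in `q₀`, shown the data `D` in column `e` and given the
counterexamples of `cexRule`. -/
def trajectory (F : ℕ → Option ℕ → Option ℕ → ℕ) (e w : ℕ) (D : ℕ → ℕ) (q₀ : ℕ) : ℕ → ℕ
  | 0 => q₀
  | n + 1 => F (trajectory F e w D q₀ n) (some (Nat.pair e (D n)))
      (cexRule e w (trajectory F e w D q₀ n))

section Trajectory

variable {F : ℕ → Option ℕ → Option ℕ → ℕ} {e : ℕ}

theorem trajectory_congr {w w' q₀ n : ℕ} {D D' : ℕ → ℕ} (hD : ∀ m < n, D m = D' m)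
    (hw : ∀ m < n, trajectory F e w' D' q₀ m ≠ Nat.pair e (Nat.pair 1 0)) :
    ∀ m ≤ n, trajectory F e w D q₀ m = trajectory F e w' D' q₀ m := by
  intro m
  induction m with
  | zero => exact fun _ => rfl
  | succ m ih =>
    intro hm
    have h := ih (by omega)
    simp only [trajectory, h, hD m (by omega), cexRule, if_neg (hw m (by omega))]

theorem trajectory_add {w q₀ n : ℕ} {D D' : ℕ → ℕ} (hD : ∀ m, D (n + m) = D' m) (m : ℕ) :
    trajectory F e w D q₀ (n + m) = trajectory F e w D' (trajectory F e w D q₀ n) m := by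
  induction m with
  | zero => rfl
  | succ m ih => rw [← add_assoc, trajectory, trajectory, ih, hD]

theorem exists_code_engine (hF : EngineComputable F) : ∃ c : Nat.Partrec.Code,
    ∀ q t x, c.eval (Encodable.encode (q, t, x)) = Part.some (F q t x) := by
  obtain ⟨c, hc⟩ := Nat.Partrec.Code.exists_code.1 hF
  refine ⟨c, fun q t x => ?_⟩
  rw [hc]
  simp only [Encodable.encodek, Part.coe_some, Part.bind_some, PFun.coe_val, Part.map_some,
    Encodable.encode_nat]

theorem simStep_trajectory {c : Nat.Partrec.Code} {p₀ : ℕ}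
    (hc : ∀ q t x, c.eval (Encodable.encode (q, t, x)) = Part.some (F q t x))
    (he : e = Nat.pair (Encodable.encode c) p₀) (w i a q₀ n : ℕ) :
    simStep e w i a n (trajectory F e w (simData i a) q₀ n) =
      Part.some (trajectory F e w (simData i a) q₀ (n + 1)) := by
  have h : Denumerable.ofNat Nat.Partrec.Code e.unpair.1 = c := by
    rw [he, Nat.unpair_pair, Denumerable.ofNat_encode]
  rw [simStep, h, hc, trajectory]

end Trajectory

/-- An engine identifying a language with a unique index keeps this index when it is shown
elements of the language without counterexamples. -/
theorem CEGISIdentifies.stable {F : ℕ → Option ℕ → Option ℕ → ℕ} {p₀ i x : ℕ}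
    {Lfam : ℕ → Set ℕ} (h : CEGISIdentifies F p₀ Lfam (Lfam i))
    (hi : ∀ j, Lfam j = Lfam i → j = i) (hx : x ∈ Lfam i) : F i (some x) none = i := by
  classical
  set τ : ℕ → Option ℕ := fun n => if n.unpair.1 ∈ Lfam i then some n.unpair.1 else none with hτ
  have hcex : ∀ q, ∃ o : Option ℕ, (Lfam q ⊆ Lfam i → o = none) ∧
      (¬ Lfam q ⊆ Lfam i → ∃ m, o = some m ∧ m ∈ Lfam q \ Lfam i) := by
    intro q
    by_cases hq : Lfam q ⊆ Lfam i
    · exact ⟨none, fun _ => rfl, fun h => absurd hq h⟩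
    · obtain ⟨m, hm⟩ := Set.not_subset.1 hq
      exact ⟨some m, fun h => absurd h hq, fun _ => ⟨m, rfl, hm⟩⟩
  choose o ho using hcex
  let Q : ℕ → ℕ := fun n => n.rec p₀ fun m q => F q (τ m) (o q)
  have hQ : cand F p₀ τ (fun n => o (Q n)) = Q := by
    funext n
    induction n with
    | zero => rfl
    | succ n ih => rw [cand, ih]
  have hτL : IsTrace τ (Lfam i) := by
    ext y
    simp only [hτ, Set.mem_ofPred_eq]
    constructor
    · rintro ⟨n, hn⟩
      split_ifs at hn with h'
      exact Option.some_injective _ hn ▸ h'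
    · exact fun hy => ⟨Nat.pair y 0, by simp [hy]⟩
  obtain ⟨N, j, hj, hN⟩ := h τ hτL (fun n => o (Q n)) (by rw [hQ]; exact fun n => ho (Q n))
  rw [hQ] at hN
  obtain rfl := hi j hj
  have h1 : N ≤ Nat.pair x N := Nat.right_le_pair x N
  have h2 := hN (Nat.pair x N + 1) (by omega)
  have h3 : Q (Nat.pair x N + 1) = F (Q (Nat.pair x N)) (τ (Nat.pair x N)) (o (Q (Nat.pair x N))) :=
    rfl
  rw [h3, hN _ h1, (ho j).1 subset_rfl] at h2
  simpa [hτ, hx] using h2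

namespace StagePair

variable (S : StagePair) {e : ℕ}

theorem family_injOn {j₀ : ℕ}
    (hj : ∀ j, (∀ x, x ∈ S.slice e j ↔ x ∈ S.slice e j₀) → j = j₀) (i : ℕ)
    (hi : S.family i = S.family (Nat.pair e j₀)) : i = Nat.pair e j₀ := by
  have h : ∀ v, v ∈ S.family i ↔ v ∈ S.family (Nat.pair e j₀) := fun v => by rw [hi]
  have he : i.unpair.1 = e := by
    have h1 := (h (Nat.pair i.unpair.1 1)).1 (S.pair_mem_family.2 ⟨rfl, S.one_mem_slice _ _⟩)
    rw [S.pair_mem_family, Nat.unpair_pair] at h1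
    exact h1.1
  have h2 : i.unpair.2 = j₀ := hj _ fun x => by
    have h1 := h (Nat.pair e x)
    rw [S.pair_mem_family, S.pair_mem_family, Nat.unpair_pair, he] at h1
    simpa using h1
  rw [← he, ← h2, Nat.pair_unpair]

theorem trajectory_eventually {F : ℕ → Option ℕ → Option ℕ → ℕ} {p₀ w j₀ : ℕ} {D : ℕ → ℕ}
    (hid : ∀ i, CEGISIdentifies F p₀ S.family (S.family i))
    (hj : ∀ j, (∀ x, x ∈ S.slice e j ↔ x ∈ S.slice e j₀) → j = j₀)
    (hD : ∀ x, (∃ n, D n = x) ↔ x ∈ S.slice e j₀)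
    (hw : ∀ n, trajectory F e w D p₀ n = Nat.pair e (Nat.pair 1 0) →
      1 ≤ w ∧ w ∉ S.slice e j₀)
    (hsub : ∀ n j, trajectory F e w D p₀ n = Nat.pair e j → j ≠ Nat.pair 1 0 →
      S.slice e j ⊆ S.slice e j₀) :
    ∃ N, ∀ n ≥ N, trajectory F e w D p₀ n = Nat.pair e j₀ := by
  set Q := trajectory F e w D p₀ with hQ
  set τ : ℕ → Option ℕ := fun n => some (Nat.pair e (D n)) with hτ
  have hcand : cand F p₀ τ (fun n => cexRule e w (Q n)) = Q := by
    funext n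
    induction n with
    | zero => rfl
    | succ n ih => rw [cand, ih]; rfl
  have htrace : IsTrace τ (S.family (Nat.pair e j₀)) := by
    ext v
    simp only [hτ, Set.mem_ofPred_eq, Option.some.injEq, mem_family, Nat.unpair_pair]
    constructor
    · rintro ⟨n, rfl⟩
      simpa using (hD (D n)).1 ⟨n, rfl⟩
    · rintro ⟨h1, h2⟩
      obtain ⟨n, hn⟩ := (hD _).2 h2
      exact ⟨n, by rw [hn, ← h1, Nat.pair_unpair]⟩
  have hadm : CexAdmissible S.family (S.family (Nat.pair e j₀)) Q fun n => cexRule e w (Q n) := by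
    intro n
    have key : (cexRule e w (Q n) = none ∧ S.family (Q n) ⊆ S.family (Nat.pair e j₀)) ∨
        ∃ m, cexRule e w (Q n) = some m ∧ m ∈ S.family (Q n) \ S.family (Nat.pair e j₀) := by
      by_cases h1 : Q n = Nat.pair e (Nat.pair 1 0)
      · obtain ⟨h2, h3⟩ := hw n h1
        refine Or.inr ⟨Nat.pair e w, by rw [cexRule, if_pos h1], ?_, ?_⟩
        · rw [h1, S.pair_mem_family, Nat.unpair_pair]
          exact ⟨rfl, S.mem_slice_pos.2 h2⟩
        · rw [S.pair_mem_family, Nat.unpair_pair]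
          exact fun h => h3 h.2
      by_cases h2 : (Q n).unpair.1 = e
      · refine Or.inl ⟨by rw [cexRule, if_neg h1, if_pos h2], fun v hv => ?_⟩
        have h3 : Q n = Nat.pair e (Q n).unpair.2 := by rw [← h2, Nat.pair_unpair]
        have h4 := hsub n _ h3 (fun h => h1 (by rw [h3, h]))
        rw [mem_family, h2] at hv
        rw [mem_family, Nat.unpair_pair]
        exact ⟨hv.1, h4 hv.2⟩
      · refine Or.inr ⟨_, by rw [cexRule, if_neg h1, if_neg h2], ?_, ?_⟩
        · exact S.pair_mem_family.2 ⟨rfl, S.one_mem_slice _ _⟩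
        · rw [S.pair_mem_family, Nat.unpair_pair]
          exact fun h => h2 h.1
    rcases key with ⟨h1, h2⟩ | ⟨m, h1, h2⟩
    · exact ⟨fun _ => h1, fun h => absurd h2 h⟩
    · exact ⟨fun h => absurd (h h2.1) h2.2, fun _ => ⟨m, h1, h2⟩⟩
  obtain ⟨N, i, hi, hN⟩ := hid (Nat.pair e j₀) τ htrace _ (by rw [hcand]; exact hadm)
  rw [hcand] at hN
  rw [S.family_injOn hj i hi] at hN
  exact ⟨N, hN⟩

theorem slice_pos_unique (j : ℕ)
    (h : ∀ x, x ∈ S.slice e j ↔ x ∈ S.slice e (Nat.pair 1 0)) : j = Nat.pair 1 0 := by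
  simp only [mem_slice_pos] at h
  rcases S.slice_cases e j with hj | ⟨k, a, rfl, hk⟩ | ⟨k, v, rfl, hk⟩ | hj
  · exact hj
  · simpa [S.mem_slice_fst hk] using h 0
  · simpa [S.mem_slice_snd hk, mem_gapSet] using h 0
  · simpa [hj] using h 2

theorem slice_fst_unique {t a : ℕ} (ht : S.fst e t = some a) (j : ℕ)
    (h : ∀ x, x ∈ S.slice e j ↔ x ∈ S.slice e (Nat.pair 2 t)) : j = Nat.pair 2 t := by
  simp only [S.mem_slice_fst ht] at h
  rcases S.slice_cases e j with rfl | ⟨k, b, rfl, hk⟩ | ⟨k, v, rfl, hk⟩ | hj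
  · simpa [S.mem_slice_pos] using h 0
  · rw [S.fst_unique e k t (by simp [hk]) (by simp [ht])]
  · obtain ⟨hv, t', ht'⟩ := S.snd_spec e k v hk
    obtain rfl := S.fst_unique e t' t (by simp [ht']) (by simp [ht])
    have hva : v.unpair.1 = a := Option.some_injective _ (ht'.symm.trans ht)
    have h5 := (h (a + 5)).1 (by
      rw [S.mem_slice_snd hk, mem_gapSet, hva]
      exact Or.inr (Or.inr ⟨le_rfl, by simp, by simp; omega⟩))
    omega
  · simpa [hj] using h 0

theorem slice_snd_unique {y v : ℕ} (hy : S.snd e y = some v) (j : ℕ)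
    (h : ∀ x, x ∈ S.slice e j ↔ x ∈ S.slice e (Nat.pair 3 y)) : j = Nat.pair 3 y := by
  rcases S.slice_cases e j with rfl | ⟨k, b, rfl, hk⟩ | ⟨k, u, rfl, hk⟩ | hj
  · simpa [S.mem_slice_pos, S.mem_slice_snd hy, mem_gapSet] using h 0
  · exact (S.slice_fst_unique hk _ fun x => (h x).symm).symm
  · rw [S.snd_unique e k y (by simp [hk]) (by simp [hy])]
  · simpa [hj, S.mem_slice_snd hy, mem_gapSet] using h 0

end StagePair

theorem StagePair.family_not_inCEGIS (S : StagePair)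
    (h1 : ∀ e k a, S.fst e k = some a → ∃ r ∈ firstSim e, a = r.2 + 1)
    (h2 : ∀ e, (firstSim e).Dom → ∃ k a, S.fst e k = some a)
    (h3 : ∀ e k v, S.snd e k = some v → ∃ t a, S.fst e t = some a ∧ ∃ r ∈ secondSim e t a,
      (thirdSim e t a r.2 r.1).Dom ∧ v = Nat.pair a r.2)
    (h4 : ∀ e t a r, S.fst e t = some a → r ∈ secondSim e t a →
      (thirdSim e t a r.2 r.1).Dom → ∃ k v, S.snd e k = some v) : ¬ InCEGIS S.family := by
  rintro ⟨F, p₀, hF, hid⟩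
  obtain ⟨c, hc⟩ := exists_code_engine hF
  obtain ⟨e, he⟩ : ∃ e, e = Nat.pair (Encodable.encode c) p₀ := ⟨_, rfl⟩
  have he2 : e.unpair.2 = p₀ := by rw [he, Nat.unpair_pair]
  have hstep := simStep_trajectory hc he
  by_cases hd1 : (firstSim e).Dom
  swap
  -- the first simulation does not halt: all positive numbers are not identified
  · have hno : ∀ n, trajectory F e 0 (simData 0 0) p₀ n ≠ Nat.pair e (Nat.pair 1 0) := by
      intro n hn
      apply hd1
      rw [firstSim, he2]
      exact haltPart_dom (hstep 0 0 0 p₀) ⟨n, by simp [hn]⟩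
    have hfst : ∀ k a, S.fst e k ≠ some a := fun k a h => by
      obtain ⟨r, hr, -⟩ := h1 e k a h
      exact hd1 (Part.dom_iff_mem.2 ⟨r, hr⟩)
    obtain ⟨N, hN⟩ := S.trajectory_eventually (w := 0) (D := simData 0 0) hid S.slice_pos_unique
      (fun x => by
        rw [S.mem_slice_pos]
        exact ⟨by rintro ⟨n, rfl⟩; simp [simData], fun h => ⟨x - 1, by simp [simData]; omega⟩⟩)
      (fun n h => absurd h (hno n)) (fun n j hn hj x hx => by
        rw [S.mem_slice_pos]
        rcases S.slice_cases e j with h | ⟨k, a, -, hk⟩ | ⟨k, v, -, hk⟩ | h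
        · exact absurd h hj
        · exact absurd hk (hfst k a)
        · obtain ⟨-, t, ht⟩ := S.snd_spec e k v hk
          exact absurd ht (hfst t _)
        · exact ((h x).1 hx).ge)
    exact hno N (hN N le_rfl)
  obtain ⟨t, a, ht⟩ := h2 e hd1
  have htu : ∀ t' a', S.fst e t' = some a' → t' = t ∧ a' = a := by
    intro t' a' h
    obtain rfl := S.fst_unique e t' t (by simp [h]) (by simp [ht])
    exact ⟨rfl, Option.some_injective _ (h.symm.trans ht)⟩
  by_cases hd2 : (secondSim e t a).Dom
  swap
  -- the second simulation does not halt: all positive numbers are not identified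
  · have hno : ∀ n, ¬ (trajectory F e 0 (simData 1 a) p₀ n = Nat.pair e (Nat.pair 1 0) ∨
        trajectory F e 0 (simData 1 a) p₀ n = Nat.pair e (Nat.pair 2 t)) := by
      intro n hn
      apply hd2
      rw [secondSim, he2]
      exact haltPart_dom (hstep 0 1 a p₀) ⟨n, decide_eq_true hn⟩
    obtain ⟨N, hN⟩ := S.trajectory_eventually (w := 0) (D := simData 1 a) hid S.slice_pos_unique
      (fun x => by rw [S.mem_slice_pos]; exact exists_gapData_eq)
      (fun n h => absurd (Or.inl h) (hno n)) (fun n j hn hj x hx => by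
        rw [S.mem_slice_pos]
        rcases S.slice_cases e j with h | ⟨k, b, hj', hk⟩ | ⟨k, v, -, hk⟩ | h
        · exact absurd h hj
        · obtain ⟨rfl, rfl⟩ := htu k b hk
          exact absurd (Or.inr (hn.trans (by rw [hj']))) (hno n)
        · obtain ⟨t', a', ht', r, hr, -⟩ := h3 e k v hk
          obtain ⟨rfl, rfl⟩ := htu t' a' ht'
          exact absurd (Part.dom_iff_mem.2 ⟨r, hr⟩) hd2
        · exact ((h x).1 hx).ge)
    exact hno N (Or.inl (hN N le_rfl))
  obtain ⟨r, hr⟩ := Part.dom_iff_mem.1 hd2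
  have hru : ∀ r' ∈ secondSim e t a, r' = r := fun r' h => Part.mem_unique h hr
  obtain ⟨hr1, hr2, hr3⟩ : r.1 = trajectory F e 0 (simData 1 a) p₀ r.2 ∧
      (r.1 = Nat.pair e (Nat.pair 1 0) ∨ r.1 = Nat.pair e (Nat.pair 2 t)) ∧
      ∀ m < r.2, ¬ (trajectory F e 0 (simData 1 a) p₀ m = Nat.pair e (Nat.pair 1 0) ∨
        trajectory F e 0 (simData 1 a) p₀ m = Nat.pair e (Nat.pair 2 t)) := by
    have hr' := hr
    rw [secondSim, he2] at hr'
    have h := mem_haltPart_total (hstep 0 1 a p₀) hr'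
    exact ⟨h.1, h.1 ▸ of_decide_eq_true h.2.1, fun m hm => of_decide_eq_false (h.2.2 m hm)⟩
  set w := a + 4 * r.2 + 4 with hw
  -- the third simulation, preceded by `n` steps of another one
  have hglue : ∀ i b n, (∀ m < n,
      trajectory F e 0 (simData i b) p₀ m ≠ Nat.pair e (Nat.pair 1 0)) →
      trajectory F e 0 (simData i b) p₀ n = r.1 → ∀ D : ℕ → ℕ,
      D = (fun m => if m < n then simData i b m else simData 2 a (m - n)) →
      (∀ m ≤ n, trajectory F e w D p₀ m = trajectory F e 0 (simData i b) p₀ m) ∧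
      ∀ m, trajectory F e w D p₀ (n + m) = trajectory F e w (simData 2 a) r.1 m := by
    rintro i b n hn hnr D rfl
    have h := trajectory_congr (F := F) (w := w) (D := fun m =>
      if m < n then simData i b m else simData 2 a (m - n)) (fun m hm => if_pos hm) hn
    refine ⟨h, fun m => ?_⟩
    rw [trajectory_add (D' := simData 2 a) (fun m => by simp), h n le_rfl, hnr]
  have hgD : ∀ i b n x, (∃ m, (if m < n then simData i b m else simData 2 a (m - n)) = x) ↔
      x ≤ a ∨ ∃ m < n, simData i b m = x := by
    intro i b n x
    constructor
    · rintro ⟨m, hm⟩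
      split_ifs at hm with h
      · exact Or.inr ⟨m, h, hm⟩
      · exact Or.inl (exists_mod_eq.1 ⟨_, hm⟩)
    · rintro (h | ⟨m, hm, hx⟩)
      · obtain ⟨m, hm⟩ := exists_mod_eq.2 h
        exact ⟨n + m, by simpa [simData] using hm⟩
      · exact ⟨m, by rw [if_pos hm, hx]⟩
  by_cases hd3 : (thirdSim e t a r.2 r.1).Dom
  swap
  -- the third simulation does not halt: the initial segment is not identified
  · have hno : ∀ n, trajectory F e w (simData 2 a) r.1 n ≠ Nat.pair e (Nat.pair 2 t) := by
      intro n hn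
      apply hd3
      exact haltPart_dom (hstep w 2 a r.1) ⟨n, decide_eq_true hn⟩
    have hrp : r.1 = Nat.pair e (Nat.pair 1 0) := hr2.resolve_right (hno 0)
    obtain ⟨s, hs, has⟩ := h1 e t a ht
    rw [firstSim, he2] at hs
    obtain ⟨-, hs2, hs3⟩ := mem_haltPart_total (hstep 0 0 0 p₀) hs
    obtain ⟨D, hD⟩ : ∃ D : ℕ → ℕ, D = fun m =>
      if m < s.2 then simData 0 0 m else simData 2 a (m - s.2) := ⟨_, rfl⟩
    obtain ⟨-, hQ⟩ := hglue 0 0 s.2 (fun m hm => of_decide_eq_false (hs3 m hm))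
      ((of_decide_eq_true hs2).trans hrp.symm) D hD
    obtain ⟨N, hN⟩ := S.trajectory_eventually (w := w) (D := D) hid (S.slice_fst_unique ht)
      (fun x => by
        rw [S.mem_slice_fst ht, hD, hgD]
        refine ⟨?_, Or.inl⟩
        rintro (h | ⟨m, hm, rfl⟩)
        · exact h
        · simp [simData]; omega)
      (fun n _ => by rw [S.mem_slice_fst ht]; omega) (fun n j hn hj x hx => by
        rcases S.slice_cases e j with h | ⟨k, b, rfl, hk⟩ | ⟨k, v, -, hk⟩ | h
        · exact absurd h hj
        · obtain ⟨rfl, rfl⟩ := htu k b hk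
          exact hx
        · obtain ⟨t', a', ht', r', hr', h', -⟩ := h3 e k v hk
          obtain ⟨rfl, rfl⟩ := htu t' a' ht'
          exact absurd (hru r' hr' ▸ h') hd3
        · rw [(h x).1 hx]; exact S.one_mem_slice _ _)
    exact hno N (by rw [← hQ N, hN _ (by omega)])
  -- all simulations halt: the set with gaps is not identified
  obtain ⟨y, v, hy⟩ := h4 e t a r ht hr hd3
  obtain rfl : v = Nat.pair a r.2 := by
    obtain ⟨t', a', ht', r', hr', -, hv⟩ := h3 e y v hy
    obtain ⟨rfl, rfl⟩ := htu t' a' ht'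
    rw [hv, hru r' hr']
  obtain ⟨D, hD⟩ : ∃ D : ℕ → ℕ, D = fun m =>
    if m < r.2 then simData 1 a m else simData 2 a (m - r.2) := ⟨_, rfl⟩
  have hnp : ∀ m < r.2, trajectory F e 0 (simData 1 a) p₀ m ≠ Nat.pair e (Nat.pair 1 0) :=
    fun m hm h => hr3 m hm (Or.inl h)
  obtain ⟨-, hQ⟩ := hglue 1 a r.2 hnp hr1.symm D hD
  have hB : ∀ x, x ∈ S.slice e (Nat.pair 3 y) ↔ x ∈ gapSet a r.2 := fun x => by
    rw [S.mem_slice_snd hy, Nat.unpair_pair]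
  obtain ⟨N, hN⟩ := S.trajectory_eventually (w := w) (D := D) hid (S.slice_snd_unique hy)
    (fun x => by
      rw [hB, hD, hgD, mem_gapSet_iff_gapData]
      simp [simData])
    (fun n _ => by rw [hB, mem_gapSet]; omega) (fun n j hn hj x hx => by
      rcases S.slice_cases e j with h | ⟨k, b, rfl, hk⟩ | ⟨k, v, rfl, hk⟩ | h
      · exact absurd h hj
      · obtain ⟨rfl, rfl⟩ := htu k b hk
        rw [hB, mem_gapSet]
        exact Or.inl ((S.mem_slice_fst hk).1 hx)
      · rwa [← S.snd_unique e k y (by simp [hk]) (by simp [hy])]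
      · rw [(h x).1 hx]; exact S.one_mem_slice _ _)
  obtain ⟨s, hs⟩ := Part.dom_iff_mem.1 hd3
  have hs2 : trajectory F e w (simData 2 a) r.1 s.2 = Nat.pair e (Nat.pair 2 t) :=
    of_decide_eq_true (mem_haltPart_total (hstep w 2 a r.1) hs).2.1
  have hstay : ∀ m, trajectory F e w (simData 2 a) r.1 (s.2 + m) = Nat.pair e (Nat.pair 2 t) := by
    intro m
    induction m with
    | zero => exact hs2
    | succ m ih =>
      have hrule : cexRule e w (Nat.pair e (Nat.pair 2 t)) = none := by
        simp [cexRule]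
      rw [← add_assoc, trajectory, ih, hrule]
      refine (hid _).stable (S.family_injOn (S.slice_fst_unique ht)) ?_
      rw [S.pair_mem_family, Nat.unpair_pair, S.mem_slice_fst ht]
      exact ⟨rfl, exists_mod_eq.1 ⟨_, rfl⟩⟩
  have h5 := hN (r.2 + (s.2 + N)) (by omega)
  rw [hQ, hstay] at h5
  simp at h5

/-- the classes CEGIS and HCEGIS are incomparable: some indexed
family is identified by a CEGIS engine but by no HCEGIS engine, and some indexed
family is identified by an HCEGIS engine but by no CEGIS engine. -/
theorem cegis_hcegis_incomparable :
    (∃ Lfam : ℕ → Set ℕ, IsIndexedFamily Lfam ∧ InCEGIS Lfam ∧ ¬ InHCEGIS Lfam) ∧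
    (∃ Lfam : ℕ → Set ℕ, IsIndexedFamily Lfam ∧ InHCEGIS Lfam ∧ ¬ InCEGIS Lfam) := by
  obtain ⟨S, h1, h2, h3, h4⟩ := exists_stagePair
  exact ⟨⟨segmentFamily, segmentFamily_isIndexedFamily, segmentFamily_inCEGIS,
    segmentFamily_not_inHCEGIS⟩, ⟨S.family, S.family_isIndexedFamily, S.family_inHCEGIS,
    S.family_not_inCEGIS h1 h2 h3 h4⟩⟩
end

section
/- The indexed family of languages 𝓛 = (L_i)_{i∈ℕ} over ℕ given by L_0 = ℕ and L_{i+1} = ℕ ∖ {i} is not identifiable in the limit from positive examples alone: there is no limit learner from positive examples that identifies every member of 𝓛 from text. -/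
/-- A limit learner from positive examples `M` identifies the language `L` of
the indexed family `Lfam` from text: on every trace for `L`, the guesses of `M`
on the finite prefixes of the trace are eventually constant with a value `j`
such that `Lfam j = L`. -/
def TextIdentifies (M : List (Option ℕ) → ℕ) (Lfam : ℕ → Set ℕ) (L : Set ℕ) : Prop :=
  ∀ τ : ℕ → Option ℕ, IsTrace τ L →
    ∃ N j, Lfam j = L ∧ ∀ n ≥ N, M ((List.range n).map τ) = j

/-- An increasing chain of lists of unbounded length has a limit sequence. -/
lemma exists_limit_of_prefix_chain {α : Type*} [Inhabited α] (s : ℕ → List α)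
    (hpre : ∀ n, s n <+: s (n + 1)) (hlen : ∀ n, n ≤ (s n).length) :
    ∃ τ : ℕ → α, ∀ n, (List.range (s n).length).map τ = s n := by
  have hmono : ∀ m n, m ≤ n → s m <+: s n := by
    intro m n h
    induction h with
    | refl => exact List.prefix_rfl
    | step _ ih => exact ih.trans (hpre _)
  refine ⟨fun k => (s (k + 1))[k]'(hlen (k + 1)), fun n => ?_⟩
  refine List.ext_getElem (by simp) fun k hk hk' => ?_
  simp only [List.getElem_map, List.getElem_range]
  rcases le_total (k + 1) n with h | h
  · exact (hmono _ _ h).getElem _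
  · exact ((hmono _ _ h).getElem _).symm

/-- A learner that identifies `ℕ` from text has a locking sequence: a finite sequence
after which it only guesses indices of `ℕ`. -/
lemma TextIdentifies.exists_locking {M : List (Option ℕ) → ℕ} {Lfam : ℕ → Set ℕ}
    (hM : TextIdentifies M Lfam Set.univ) :
    ∃ σ, ∀ ρ, Lfam (M (σ ++ ρ)) = Set.univ := by
  by_contra! hcon
  choose ρ hρ using hcon
  let s : ℕ → List (Option ℕ) := fun n =>
    Nat.rec [] (fun k l => (l ++ [some k]) ++ ρ (l ++ [some k])) n
  have hstep : ∀ n, s (n + 1) = (s n ++ [some n]) ++ ρ (s n ++ [some n]) := fun _ => rfl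
  have hlen : ∀ n, n ≤ (s n).length := by
    intro n
    induction n with
    | zero => exact Nat.zero_le _
    | succ k ih =>
      rw [hstep]
      simp only [List.length_append, List.length_singleton]
      omega
  obtain ⟨τ, hτ⟩ := exists_limit_of_prefix_chain s
    (fun n => by rw [hstep, List.append_assoc]; exact List.prefix_append _ _) hlen
  have htrace : IsTrace τ Set.univ := by
    refine Set.eq_univ_of_forall fun x => ?_
    have hx : some x ∈ s (x + 1) := by simp [hstep]
    rw [← hτ (x + 1), List.mem_map] at hx
    obtain ⟨n, -, hn⟩ := hx
    exact ⟨n, hn⟩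
  obtain ⟨N, j, hj, hN⟩ := hM τ htrace
  have hval := hN (s (N + 1)).length ((Nat.le_succ N).trans (hlen (N + 1)))
  rw [hτ (N + 1), hstep] at hval
  exact hρ _ (by rw [hval, hj])

/-- Every finite sequence avoiding `i` extends to a trace for `ℕ \ {i}`. -/
lemma exists_trace_extending (σ : List (Option ℕ)) (i : ℕ) (hi : some i ∉ σ) :
    ∃ τ, IsTrace τ (Set.univ \ {i}) ∧
      ∀ n ≥ σ.length, ∃ ρ, (List.range n).map τ = σ ++ ρ := by
  let f : ℕ → Option ℕ := fun k => if k = i then none else some k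
  let τ : ℕ → Option ℕ := fun n =>
    if h : n < σ.length then σ[n] else f (n - σ.length)
  refine ⟨τ, ?_, ?_⟩
  · ext x
    simp only [Set.mem_ofPred_eq, Set.mem_sdiff, Set.mem_univ, true_and, Set.mem_singleton_iff]
    constructor
    · rintro ⟨n, hn⟩ rfl
      by_cases h : n < σ.length
      · simp only [τ, h, dite_true] at hn
        exact hi (hn ▸ List.getElem_mem h)
      · simp only [τ, h, dite_false, f] at hn
        split_ifs at hn with hk
        exact hk (Option.some.inj hn)
    · intro hx
      exact ⟨σ.length + x, by simp [τ, f, hx]⟩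
  · intro n hn
    obtain ⟨m, rfl⟩ := Nat.exists_eq_add_of_le hn
    refine ⟨(List.range m).map f, ?_⟩
    rw [List.range_add, List.map_append, List.map_map]
    congr 1
    · refine List.ext_getElem (by simp) fun k hk hk' => ?_
      simp [τ, hk']
    · refine List.map_congr_left fun k _ => ?_
      simp [τ]

/-- the indexed family with `L 0 = ℕ` and `L (i+1) = ℕ \ {i}` is
not identifiable in the limit from positive examples alone: no computable limit
learner identifies every member of the family from text. -/
theorem not_text_learnable (Lfam : ℕ → Set ℕ) (h0 : Lfam 0 = Set.univ)
    (hs : ∀ i, Lfam (i + 1) = Set.univ \ {i}) :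
    ¬ ∃ M : List (Option ℕ) → ℕ, Computable M ∧
        ∀ i, TextIdentifies M Lfam (Lfam i) := by
  rintro ⟨M, -, hM⟩
  obtain ⟨σ, hσ⟩ := (h0 ▸ hM 0 : TextIdentifies M Lfam Set.univ).exists_locking
  obtain ⟨i, hi⟩ := Infinite.exists_notMem_finset (σ.filterMap id).toFinset
  obtain ⟨τ, hτ, hext⟩ := exists_trace_extending σ i (by simpa using hi)
  obtain ⟨N, j, hj, hN⟩ := hM (i + 1) τ (by rw [hs]; exact hτ)
  obtain ⟨ρ, hρ⟩ := hext (max N σ.length) (le_max_right _ _)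
  have hval := hN (max N σ.length) (le_max_left _ _)
  have huniv := hσ ρ
  rw [← hρ, hval, hj, hs] at huniv
  have hmem : i ∈ Set.univ \ {i} := by rw [huniv]; exact Set.mem_univ i
  exact hmem.2 rfl
end

section
/- The indexed family of languages 𝓛 = (L_i)_{i∈ℕ} over ℕ given by L_0 = ℕ and L_{i+1} = ℕ ∖ {i} is identified by some CEGIS engine: the engine whose initial conjecture is ℕ, which keeps conjecturing ℕ while no counterexample is returned and, upon receiving a counterexample x, conjectures ℕ ∖ {x} forever, identifies every member of 𝓛 (so this family, which is not learnable from positive examples alone, is in the class CEGIS). -/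
/-- The update function that keeps the conjecture when no counterexample is returned and
conjectures index `x + 1` upon receiving the counterexample `x`. -/
def coSingletonUpdate (p : ℕ) (_ c : Option ℕ) : ℕ :=
  c.elim p (· + 1)

theorem engineComputable_coSingletonUpdate : EngineComputable coSingletonUpdate := by
  have h : Computable fun x : ℕ × Option ℕ × Option ℕ =>
      Option.casesOn (motive := fun _ => ℕ) x.2.2 x.1 Nat.succ :=
    Computable.option_casesOn (Computable.snd.comp Computable.snd) Computable.fst
      (Computable.succ.comp Computable.snd)
  refine h.of_eq ?_
  rintro ⟨p, t, _ | x⟩ <;> rfl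

/-- Once a candidate is contained in the target, an engine that keeps its conjecture in the
absence of counterexamples never changes its candidate again. -/
theorem cand_eq_of_subset {F : ℕ → Option ℕ → Option ℕ → ℕ} {p₀ : ℕ} {Lfam : ℕ → Set ℕ}
    {L : Set ℕ} {τ cex : ℕ → Option ℕ} (hF : ∀ p t, F p t none = p)
    (hcex : CexAdmissible Lfam L (cand F p₀ τ cex) cex) {N : ℕ}
    (hN : Lfam (cand F p₀ τ cex N) ⊆ L) {n : ℕ} (hn : N ≤ n) :
    cand F p₀ τ cex n = cand F p₀ τ cex N := by
  induction n, hn using Nat.le_induction with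
  | base => rfl
  | succ n _ ih =>
    have hnone : cex n = none := (hcex n).1 (ih ▸ hN)
    rw [cand, hnone, hF, ih]

/-- the family with `L 0 = ℕ` and `L (i+1) = ℕ \ {i}` is identified
by the CEGIS engine whose initial conjecture is `ℕ` (index `0`), which keeps its
conjecture while no counterexample is returned and, upon receiving a
counterexample `x`, conjectures `ℕ \ {x}` (index `x + 1`) forever; in particular
this family is in the class CEGIS. -/
theorem coSingletons_in_cegis (Lfam : ℕ → Set ℕ) (h0 : Lfam 0 = Set.univ)
    (hs : ∀ i, Lfam (i + 1) = Set.univ \ {i}) :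
    ∃ F : ℕ → Option ℕ → Option ℕ → ℕ, ∃ p₀ : ℕ,
      EngineComputable F ∧ p₀ = 0 ∧
      (∀ p t, F p t none = p) ∧
      (∀ p t x, F p t (some x) = x + 1) ∧
      (∀ i, CEGISIdentifies F p₀ Lfam (Lfam i)) := by
  refine ⟨coSingletonUpdate, 0, engineComputable_coSingletonUpdate, rfl, fun _ _ => rfl,
    fun _ _ _ => rfl, ?_⟩
  rintro (_ | k) τ - cex hcex
  · exact ⟨0, 0, rfl, fun n hn => cand_eq_of_subset (fun _ _ => rfl) hcex subset_rfl hn⟩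
  · have hne : ¬ Lfam 0 ⊆ Lfam (k + 1) := by
      rw [h0, hs]
      exact fun h => (h (Set.mem_univ k)).2 rfl
    obtain ⟨m, hm, -, hmL⟩ := (hcex 0).2 hne
    have hmk : m = k := by simpa [hs] using hmL
    have h1 : cand coSingletonUpdate 0 τ cex 1 = k + 1 := by
      simp [cand, coSingletonUpdate, hm, hmk]
    refine ⟨1, k + 1, rfl, fun n hn => ?_⟩
    rw [cand_eq_of_subset (fun _ _ => rfl) hcex (by rw [h1]) hn, h1]
end
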